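/- For the almost Mathieu operator with λ > 2, Diophantine frequency ω ∈ ℝ, and Lebesgue-almost every phase θ ∈ ℝ, the operator H_{λ,ω,θ} has only pure point spectrum with exponentially decaying eigenfunctions: there is an orthonormal basis of ℓ²(ℤ) consisting of eigenvectors of H_{λ,ω,θ}, and each eigenvector decays exponentially. -/

import Mathlib

open MeasureTheory Filter

noncomputable section

/-- The Hilbert space `ℓ²(ℤ)`. -/
abbrev l2Z := lp (fun _ : ℤ => ℂ) 2

/-- `ω` is Diophantine: `dist (nω, ℤ) ≥ c |n|^(-r)` for all nonzero integers `n`. -/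
def Diophantine (ω : ℝ) : Prop :=
  ∃ c : ℝ, 0 < c ∧ ∃ r : ℝ, 1 < r ∧
    ∀ n : ℤ, n ≠ 0 → ∀ m : ℤ, c * |(n : ℝ)| ^ (-r) ≤ |(n : ℝ) * ω - (m : ℝ)|

/-- The eigenvalue equation `ψ(n+1) + ψ(n-1) + λ cos(2π(θ+nω)) ψ(n) = E ψ(n)` of the
almost Mathieu operator. -/
def AMEigenEq (lam ω θ : ℝ) (ψ : ℤ → ℂ) (E : ℝ) : Prop :=
  ∀ n : ℤ, ψ (n + 1) + ψ (n - 1)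
      + ((lam * Real.cos (2 * Real.pi * (θ + (n : ℝ) * ω)) : ℝ) : ℂ) * ψ n = (E : ℂ) * ψ n

/-- `ψ : ℤ → ℂ` decays exponentially. -/
def ExpDecay (ψ : ℤ → ℂ) : Prop :=
  ∃ C : ℝ, 0 < C ∧ ∃ α : ℝ, 0 < α ∧ ∀ n : ℤ, ‖ψ n‖ ≤ C * Real.exp (-α * |(n : ℝ)|)

/-- The continuant of `a x, …, a (x + n - 1)`: the determinant of the tridiagonal matrix with this
diagonal and off-diagonal entries `-1`. -/
def continuant {R : Type*} [CommRing R] (a : ℤ → R) (x : ℤ) : ℕ → R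
  | 0 => 1
  | 1 => a x
  | n + 2 => a (x + n + 1) * continuant a x (n + 1) - continuant a x n

section Continuant

variable {R : Type*} [CommRing R]

theorem continuant_add_two (a : ℤ → R) (x : ℤ) (n : ℕ) :
    continuant a x (n + 2) =
      a (x + n + 1) * continuant a x (n + 1) - continuant a x n := rfl

theorem continuant_add (a : ℤ → R) (x : ℤ) (m n : ℕ) :
    continuant a x (m + n + 2) =
      continuant a x (m + 1) * continuant a (x + m + 1) (n + 1)
        - continuant a x m * continuant a (x + m + 2) n := by
  induction n using Nat.twoStepInduction with
  | zero => simp [continuant]; ring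
  | one =>
    have h : (x + m + 1 + 1 : ℤ) = x + m + 2 := by ring
    simp [continuant, add_assoc]
    ring_nf
  | more n ih1 ih2 =>
    have e1 : m + (n + 2) + 2 = (m + n + 2) + 2 := by ring
    have e2 : m + (n + 1) + 2 = (m + n + 2) + 1 := by ring
    have e3 : n + 2 + 1 = n + 1 + 2 := by ring
    rw [e2] at ih2
    rw [e1, e3]
    simp only [continuant] at ih1 ih2 ⊢
    rw [ih2, ih1]
    push_cast
    have e4 : (x + (m + n + 2) + 1 : ℤ) = x + m + 1 + (n + 1) + 1 := by ring
    have e5 : (x + m + 2 + n + 1 : ℤ) = x + m + 1 + (n + 1) + 1 := by ring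
    rw [e4, e5]
    ring

theorem continuant_shift (a : ℤ → R) (x y : ℤ) (n : ℕ) :
    continuant (fun j => a (j + y)) x n = continuant a (x + y) n := by
  induction n using Nat.twoStepInduction with
  | zero => simp [continuant]
  | one => simp [continuant]
  | more n ih1 ih2 =>
    simp only [continuant, ih1, ih2]
    congr 3
    ring

theorem continuant_reverse (a : ℤ → R) (x : ℤ) (n : ℕ) :
    continuant (fun j => a (-j)) (-x - n + 1) n = continuant a x n := by
  induction n using Nat.twoStepInduction generalizing x with
  | zero => simp [continuant]
  | one => simp [continuant]
  | more n ih1 ih2 =>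
    have h := continuant_add a x 0 n
    simp only [Nat.zero_add, continuant, Nat.cast_zero, add_zero, one_mul] at h
    have h1 := ih1 (x + 2)
    have h2 := ih2 (x + 1)
    have e1 : (-(x + 2) - (n : ℤ) + 1) = -x - ((n + 2 : ℕ) : ℤ) + 1 := by push_cast; ring
    have e2 : (-(x + 1) - ((n + 1 : ℕ) : ℤ) + 1) = -x - ((n + 2 : ℕ) : ℤ) + 1 := by
      push_cast; ring
    rw [e1] at h1
    rw [e2] at h2
    simp only [continuant] at h ⊢
    rw [h1, h2, h]
    congr 3
    push_cast
    ring

/-- Representation of a solution of `u (n + 1) + u (n - 1) = a n • u n` inside an interval through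
its values next to the two end points. -/
theorem continuant_smul_solution {M : Type*} [AddCommGroup M] [Module R M] (a : ℤ → R) (u : ℤ → M)
    (hu : ∀ n, u (n + 1) + u (n - 1) = a n • u n) (x : ℤ) (p q : ℕ) :
    continuant a x (p + q + 1) • u (x + p) =
      continuant a (x + p + 1) q • u (x - 1) + continuant a x p • u (x + p + q + 1) := by
  have hu' : ∀ n, u (n + 1) = a n • u n - u (n - 1) := fun n => eq_sub_of_add_eq (hu n)
  have base : ∀ p : ℕ, continuant a x (p + 1) • u (x + p) =
      u (x - 1) + continuant a x p • u (x + p + 1) := by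
    intro p
    induction p with
    | zero => simp [continuant, ← hu x, add_comm]
    | succ p ih =>
      simp only [continuant]
      have h := hu' (x + p + 1)
      have e : (x + p + 1 - 1 : ℤ) = x + p := by ring
      rw [e] at h
      push_cast
      rw [show (x + (p + 1) + 1 : ℤ) = x + p + 1 + 1 by ring, h, ← add_assoc]
      linear_combination (norm := module) ih
  induction q using Nat.twoStepInduction with
  | zero => simpa [continuant] using base p
  | one =>
    have h := hu' (x + p + 1)
    have e : (x + p + 1 - 1 : ℤ) = x + p := by ring
    rw [e] at h
    simp only [continuant]
    push_cast
    rw [h]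
    linear_combination (norm := module) a (x + p + 1) • base p
  | more q ih1 ih2 =>
    have h := hu' (x + p + q + 2)
    have e : (x + p + q + 2 - 1 : ℤ) = x + p + q + 1 := by ring
    rw [e] at h
    rw [show p + (q + 1) + 1 = (p + q + 1) + 1 by ring] at ih2
    rw [show p + (q + 2) + 1 = (p + q + 1) + 2 by ring]
    rw [continuant_add_two a x (p + q + 1), continuant_add_two a _ q]
    push_cast at ih2 ⊢
    rw [show (x + p + (q + 1) + 1 : ℤ) = x + p + q + 2 by ring] at ih2
    rw [show (x + p + (q + 2) + 1 : ℤ) = x + p + q + 2 + 1 by ring, h,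
      show (x + (p + q + 1) + 1 : ℤ) = x + p + q + 2 by ring,
      show (x + p + 1 + q + 1 : ℤ) = x + p + q + 2 by ring]
    linear_combination (norm := module) a (x + p + q + 2) • ih2 - ih1

end Continuant

/-- The characteristic determinant of the almost Mathieu operator restricted to `[0, n)`. -/
def amDet (lam ω E : ℝ) (n : ℕ) (θ : ℝ) : ℝ :=
  continuant (fun j : ℤ => E - lam * Real.cos (2 * Real.pi * (θ + j * ω))) 0 n

section AmDet

variable (lam ω E : ℝ)

theorem continuant_eq_amDet (θ : ℝ) (x : ℤ) (n : ℕ) :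
    continuant (fun j : ℤ => E - lam * Real.cos (2 * Real.pi * (θ + j * ω))) x n =
      amDet lam ω E n (θ + x * ω) := by
  have h := continuant_shift
    (fun j : ℤ => E - lam * Real.cos (2 * Real.pi * (θ + j * ω))) 0 x n
  rw [zero_add] at h
  rw [← h, amDet]
  congr 1
  ext j
  push_cast
  ring_nf

theorem amDet_zero (θ : ℝ) : amDet lam ω E 0 θ = 1 := rfl

theorem amDet_one (θ : ℝ) : amDet lam ω E 1 θ = E - lam * Real.cos (2 * Real.pi * θ) := by
  simp [amDet, continuant]

theorem amDet_add_two (n : ℕ) (θ : ℝ) : amDet lam ω E (n + 2) θ =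
    (E - lam * Real.cos (2 * Real.pi * (θ + (n + 1) * ω))) * amDet lam ω E (n + 1) θ
      - amDet lam ω E n θ := by
  simp [amDet, continuant]

theorem amDet_add (m n : ℕ) (θ : ℝ) : amDet lam ω E (m + n + 2) θ =
    amDet lam ω E (m + 1) θ * amDet lam ω E (n + 1) (θ + (m + 1) * ω)
      - amDet lam ω E m θ * amDet lam ω E n (θ + (m + 2) * ω) := by
  have h := continuant_add
    (fun j : ℤ => E - lam * Real.cos (2 * Real.pi * (θ + j * ω))) 0 m n
  simp only [continuant_eq_amDet] at h
  simpa using h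

theorem amDet_reflect (n : ℕ) (θ : ℝ) :
    amDet lam ω E n (-θ - (n - 1) * ω) = amDet lam ω E n θ := by
  have h := continuant_reverse
    (fun j : ℤ => E - lam * Real.cos (2 * Real.pi * (θ + j * ω))) 0 n
  have h2 : (fun j : ℤ => E - lam * Real.cos (2 * Real.pi * (θ + (-j : ℤ) * ω))) =
      fun j : ℤ => E - lam * Real.cos (2 * Real.pi * (-θ + j * ω)) := by
    ext j
    rw [← Real.cos_neg]
    push_cast
    ring_nf
  simp only [h2, continuant_eq_amDet] at h
  simp only [Int.cast_zero, zero_mul, add_zero] at h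
  rw [← h]
  congr 1
  push_cast
  ring

open Polynomial in
/-- In the variable `cos (2π t)`, centred at the midpoint of the interval, the determinant is a
polynomial of degree at most `n`. -/
theorem exists_polynomial_amDet (n : ℕ) : ∃ Q : ℝ[X], Q ∈ degreeLT ℝ (n + 1) ∧
    ∀ θ : ℝ, amDet lam ω E n θ =
      Q.eval (Real.cos (2 * Real.pi * (θ + (n - 1) / 2 * ω))) := by
  have hX : ∀ (P : ℝ[X]) (n : ℕ), P ∈ degreeLT ℝ n → X * P ∈ degreeLT ℝ (n + 1) := by
    intro P n hP
    rw [mem_degreeLT] at hP ⊢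
    rcases eq_or_ne P 0 with rfl | h0
    · simp
    · rw [degree_mul, degree_X]
      rw [degree_eq_natDegree h0] at hP ⊢
      norm_cast at hP ⊢
      omega
  have key : ∀ (s : ℝ) (n : ℕ), ∃ A B : ℝ[X], A ∈ degreeLT ℝ (n + 1) ∧ B ∈ degreeLT ℝ n ∧
      ∀ t : ℝ, amDet lam ω E n (t + s) = A.eval (Real.cos (2 * Real.pi * t)) +
        Real.sin (2 * Real.pi * t) * B.eval (Real.cos (2 * Real.pi * t)) := by
    intro s n
    have step : ∀ (σ : ℝ) (n : ℕ) (A B : ℝ[X]), A ∈ degreeLT ℝ (n + 1) → B ∈ degreeLT ℝ n →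
        ∃ A' B' : ℝ[X], A' ∈ degreeLT ℝ (n + 2) ∧ B' ∈ degreeLT ℝ (n + 1) ∧ ∀ t : ℝ,
          (E - lam * Real.cos (2 * Real.pi * (t + σ))) *
            (A.eval (Real.cos (2 * Real.pi * t)) +
              Real.sin (2 * Real.pi * t) * B.eval (Real.cos (2 * Real.pi * t))) =
          A'.eval (Real.cos (2 * Real.pi * t)) +
            Real.sin (2 * Real.pi * t) * B'.eval (Real.cos (2 * Real.pi * t)) := by
      intro σ n A B hA hB
      set a := Real.cos (2 * Real.pi * σ)
      set b := Real.sin (2 * Real.pi * σ)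
      have hA' := degreeLT_mono (R := ℝ) (Nat.le_succ (n + 1)) hA
      have hB' := degreeLT_mono (R := ℝ) (Nat.le_succ n) hB
      have hB'' := degreeLT_mono (R := ℝ) (Nat.le_succ (n + 1)) hB'
      refine ⟨E • A - (lam * a) • (X * A) + (lam * b) • B - (lam * b) • (X * (X * B)),
        E • B - (lam * a) • (X * B) + (lam * b) • A, ?_, ?_, ?_⟩
      · exact Submodule.sub_mem _ (Submodule.add_mem _ (Submodule.sub_mem _
          (Submodule.smul_mem _ _ hA') (Submodule.smul_mem _ _ (hX _ _ hA)))
          (Submodule.smul_mem _ _ hB'')) (Submodule.smul_mem _ _ (hX _ _ (hX _ _ hB)))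
      · exact Submodule.add_mem _ (Submodule.sub_mem _
          (Submodule.smul_mem _ _ hB') (Submodule.smul_mem _ _ (hX _ _ hB)))
          (Submodule.smul_mem _ _ hA)
      · intro t
        rw [mul_add (2 * Real.pi), Real.cos_add]
        simp only [eval_add, eval_sub, eval_smul, eval_mul, eval_X, smul_eq_mul]
        linear_combination (lam * b * B.eval (Real.cos (2 * Real.pi * t))) *
          Real.sin_sq_add_cos_sq (2 * Real.pi * t)
    induction n using Nat.twoStepInduction with
    | zero =>
      refine ⟨1, 0, ?_, Submodule.zero_mem _, fun t => by simp [amDet_zero]⟩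
      rw [mem_degreeLT, degree_one]
      norm_num
    | one =>
      obtain ⟨A, B, hA, hB, h⟩ := step s 0 1 0 (by rw [mem_degreeLT, degree_one]; norm_num)
        (Submodule.zero_mem _)
      exact ⟨A, B, hA, hB, fun t => by rw [← h t, amDet_one]; simp⟩
    | more n ih1 ih2 =>
      obtain ⟨A1, B1, hA1, hB1, h1⟩ := ih1
      obtain ⟨A2, B2, hA2, hB2, h2⟩ := ih2
      obtain ⟨A, B, hA, hB, h⟩ := step (s + (n + 1) * ω) (n + 1) A2 B2 hA2 hB2
      refine ⟨A - A1, B - B1, Submodule.sub_mem _ hA (degreeLT_mono (by omega) hA1),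
        Submodule.sub_mem _ hB (degreeLT_mono (by omega) hB1), fun t => ?_⟩
      rw [amDet_add_two, h1, h2, add_assoc t, h]
      simp only [eval_sub]
      ring
  obtain ⟨A, B, hA, -, h⟩ := key (-((n - 1) / 2 * ω)) n
  refine ⟨A, hA, fun θ => ?_⟩
  have h1 := h (θ + (n - 1) / 2 * ω)
  have h2 := h (-(θ + (n - 1) / 2 * ω))
  rw [mul_neg, Real.cos_neg, Real.sin_neg] at h2
  rw [show θ + (n - 1) / 2 * ω + -((n - 1) / 2 * ω) = θ by ring] at h1
  rw [show -(θ + (n - 1) / 2 * ω) + -((n - 1) / 2 * ω) = -θ - (n - 1) * ω by ring,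
    amDet_reflect] at h2
  linarith

end AmDet

section Growth

variable (lam ω E : ℝ)

theorem abs_amDet_le (n : ℕ) (θ : ℝ) : |amDet lam ω E n θ| ≤ (|E| + |lam| + 1) ^ n := by
  have hv : ∀ x : ℝ, |E - lam * Real.cos x| ≤ |E| + |lam| := fun x => by
    refine (abs_sub _ _).trans (add_le_add_right ?_ _)
    rw [abs_mul]
    exact mul_le_of_le_one_right (abs_nonneg _) (Real.abs_cos_le_one x)
  have h1 : 1 ≤ |E| + |lam| + 1 := by linarith [abs_nonneg E, abs_nonneg lam]
  induction n using Nat.twoStepInduction with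
  | zero => simp [amDet_zero]
  | one =>
    rw [amDet_one, pow_one]
    exact (hv _).trans (by linarith)
  | more n ih1 ih2 =>
    rw [amDet_add_two]
    set M := |E| + |lam| + 1 with hM
    have h2 : M ^ n ≤ M ^ (n + 1) := pow_le_pow_right₀ h1 (Nat.le_succ n)
    calc _ ≤ (|E| + |lam|) * M ^ (n + 1) + M ^ (n + 1) := by
          refine (abs_sub _ _).trans (add_le_add ?_ (ih1.trans h2))
          rw [abs_mul]
          exact mul_le_mul (hv _) ih2 (abs_nonneg _) (by positivity)
      _ = M ^ (n + 2) := by rw [pow_succ M (n + 1), hM]; ring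

/-- The supremum of `|amDet lam ω E n θ|` over all phases. -/
def amSup (n : ℕ) : ℝ := ⨆ θ, |amDet lam ω E n θ|

theorem abs_amDet_le_amSup (n : ℕ) (θ : ℝ) : |amDet lam ω E n θ| ≤ amSup lam ω E n :=
  le_ciSup (f := fun θ => |amDet lam ω E n θ|)
    ⟨_, by rintro _ ⟨θ, rfl⟩; exact abs_amDet_le lam ω E n θ⟩ θ

theorem amSup_nonneg (n : ℕ) : 0 ≤ amSup lam ω E n :=
  (abs_nonneg _).trans (abs_amDet_le_amSup lam ω E n 0)

theorem amSup_zero : amSup lam ω E 0 = 1 := by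
  simp [amSup, amDet_zero]

/-- The determinant is, up to a phase, the boundary value of an entire function whose value at the
origin is the top Fourier coefficient. -/
theorem exists_differentiable_amDet (n : ℕ) : ∃ G : ℂ → ℂ, Differentiable ℂ G ∧
    ‖G 0‖ = (|lam| / 2) ^ n ∧ ∀ θ : ℝ, G (Complex.exp (2 * Real.pi * θ * Complex.I)) =
      Complex.exp (2 * Real.pi * θ * Complex.I) ^ n * amDet lam ω E n θ := by
  have hcos : ∀ θ σ : ℝ, (Complex.exp (2 * Real.pi * θ * Complex.I)) *
      ((E - lam * Real.cos (2 * Real.pi * (θ + σ)) : ℝ) : ℂ) =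
      E * Complex.exp (2 * Real.pi * θ * Complex.I) - lam / 2 *
        (Complex.exp (2 * Real.pi * θ * Complex.I) ^ 2 *
          Complex.exp (2 * Real.pi * σ * Complex.I) +
          Complex.exp (-(2 * Real.pi * σ * Complex.I))) := by
    intro θ σ
    push_cast
    rw [Complex.cos, show 2 * (Real.pi : ℂ) * (θ + σ) * Complex.I =
      2 * Real.pi * θ * Complex.I + 2 * Real.pi * σ * Complex.I by ring,
      show -(2 * (Real.pi : ℂ) * (θ + σ)) * Complex.I =
      -(2 * Real.pi * θ * Complex.I) + -(2 * Real.pi * σ * Complex.I) by ring,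
      Complex.exp_add, Complex.exp_add, Complex.exp_neg (2 * Real.pi * θ * Complex.I)]
    have := Complex.exp_ne_zero (2 * Real.pi * θ * Complex.I)
    field_simp
  have hnorm : ∀ σ : ℝ, ‖Complex.exp (-(2 * Real.pi * σ * Complex.I))‖ = 1 := by
    intro σ
    rw [show -(2 * (Real.pi : ℂ) * σ * Complex.I) = ((-(2 * Real.pi * σ) : ℝ) : ℂ) * Complex.I by
      push_cast; ring]
    exact Complex.norm_exp_ofReal_mul_I _
  induction n using Nat.twoStepInduction with
  | zero => exact ⟨fun _ => 1, differentiable_const _, by simp, fun θ => by simp [amDet_zero]⟩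
  | one =>
    refine ⟨fun w => E * w - lam / 2 * (w ^ 2 * Complex.exp (2 * Real.pi * (0 : ℝ) * Complex.I) +
      Complex.exp (-(2 * Real.pi * (0 : ℝ) * Complex.I))), by fun_prop, by simp, fun θ => ?_⟩
    rw [amDet_one, pow_one]
    exact (hcos θ 0).symm.trans (by rw [add_zero])
  | more n ih1 ih2 =>
    obtain ⟨G1, d1, -, h1⟩ := ih1
    obtain ⟨G2, d2, z2, h2⟩ := ih2
    refine ⟨fun w => (E * w - lam / 2 *
      (w ^ 2 * Complex.exp (2 * Real.pi * (((n + 1) * ω : ℝ) : ℂ) * Complex.I) +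
      Complex.exp (-(2 * Real.pi * (((n + 1) * ω : ℝ) : ℂ) * Complex.I)))) * G2 w - w ^ 2 * G1 w,
      by fun_prop, ?_, fun θ => ?_⟩
    · have h := hnorm ((n + 1) * ω)
      simp only [mul_zero, ne_eq, OfNat.ofNat_ne_zero, not_false_eq_true, zero_pow, zero_mul,
        zero_add, zero_sub, sub_zero, norm_mul, norm_neg, h, z2]
      simp
      ring
    · simp only [← hcos, h1, h2, amDet_add_two]
      push_cast
      ring

theorem pow_le_amSup (n : ℕ) : (|lam| / 2) ^ n ≤ amSup lam ω E n := by
  obtain ⟨G, hd, h0, h⟩ := exists_differentiable_amDet lam ω E n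
  rw [← h0]
  refine Complex.norm_le_of_forall_mem_frontier_norm_le (U := Metric.ball 0 1)
    Metric.isBounded_ball hd.diffContOnCl (fun z hz => ?_)
    (subset_closure (Metric.mem_ball_self one_pos))
  rw [frontier_ball _ one_ne_zero, mem_sphere_zero_iff_norm] at hz
  have hz' : z = Complex.exp (2 * Real.pi * ((z.arg / (2 * Real.pi) : ℝ) : ℂ) * Complex.I) := by
    conv_lhs => rw [← Complex.norm_mul_exp_arg_mul_I z, hz]
    push_cast
    rw [mul_div_cancel₀ _ (by simp [Real.pi_ne_zero])]
    simp
  have hn := congrArg norm (h (z.arg / (2 * Real.pi)))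
  rw [← hz', norm_mul, norm_pow, hz, one_pow, one_mul, Complex.norm_real, Real.norm_eq_abs] at hn
  rw [hn]
  exact abs_amDet_le_amSup _ _ _ _ _

theorem amSup_add_le (m n : ℕ) : amSup lam ω E (m + n) ≤
    amSup lam ω E m * amSup lam ω E n + amSup lam ω E (m - 1) * amSup lam ω E (n - 1) := by
  have hs := amSup_nonneg lam ω E
  rcases m with _ | m
  · simp only [zero_add, amSup_zero, one_mul, Nat.zero_sub]
    exact le_add_of_nonneg_right (hs _)
  rcases n with _ | n
  · simp only [add_zero, amSup_zero, mul_one, Nat.zero_sub]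
    exact le_add_of_nonneg_right (hs _)
  refine ciSup_le fun θ => ?_
  rw [show m + 1 + (n + 1) = m + n + 2 by ring, amDet_add]
  refine (abs_sub _ _).trans ?_
  rw [abs_mul, abs_mul]
  exact add_le_add
    (mul_le_mul (abs_amDet_le_amSup ..) (abs_amDet_le_amSup ..) (abs_nonneg _) (hs _))
    (mul_le_mul (abs_amDet_le_amSup ..) (abs_amDet_le_amSup ..) (abs_nonneg _) (hs _))

/-- The maximum of three consecutive suprema, comparable to the norm of a transfer matrix. -/
def amSupMax (n : ℕ) : ℝ :=
  max (amSup lam ω E n) (max (amSup lam ω E (n - 1)) (amSup lam ω E (n - 2)))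

theorem amSupMax_add_le (m n : ℕ) :
    amSupMax lam ω E (m + n) ≤ 2 * (amSupMax lam ω E m * amSupMax lam ω E n) := by
  have hs := amSup_nonneg lam ω E
  have l0 : ∀ n, amSup lam ω E n ≤ amSupMax lam ω E n := fun n => le_max_left _ _
  have l1 : ∀ n, amSup lam ω E (n - 1) ≤ amSupMax lam ω E n :=
    fun n => (le_max_left _ _).trans (le_max_right _ _)
  have l2 : ∀ n, amSup lam ω E (n - 2) ≤ amSupMax lam ω E n :=
    fun n => (le_max_right _ _).trans (le_max_right _ _)
  have ht : ∀ n, 0 ≤ amSupMax lam ω E n := fun n => (hs n).trans (l0 n)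
  have hz : amSupMax lam ω E 0 = 1 := by simp [amSupMax, amSup_zero]
  have key : ∀ i j, amSup lam ω E i ≤ amSupMax lam ω E m →
      amSup lam ω E (i - 1) ≤ amSupMax lam ω E m → amSup lam ω E j ≤ amSupMax lam ω E n →
      amSup lam ω E (j - 1) ≤ amSupMax lam ω E n →
      amSup lam ω E (i + j) ≤ 2 * (amSupMax lam ω E m * amSupMax lam ω E n) := by
    intro i j h1 h2 h3 h4
    refine (amSup_add_le lam ω E i j).trans ?_
    rw [two_mul]
    exact add_le_add (mul_le_mul h1 h3 (hs _) (ht _)) (mul_le_mul h2 h4 (hs _) (ht _))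
  rcases m with _ | m
  · rw [hz, zero_add]
    linarith [ht n]
  rcases n with _ | n
  · rw [hz, add_zero]
    linarith [ht (m + 1)]
  refine max_le (key _ _ (l0 _) (l1 _) (l0 _) (l1 _)) (max_le ?_ ?_)
  · exact key (m + 1) n (l0 _) (l1 _) (l1 (n + 1)) (l2 (n + 1))
  · rw [show m + 1 + (n + 1) - 2 = m + n by omega]
    exact key m n (l1 (m + 1)) (l2 (m + 1)) (l1 (n + 1)) (l2 (n + 1))

/-- Existence and positivity of the exponential growth rate of the determinants. -/
theorem exists_growth_rate (hlam : 2 < lam) : ∃ L : ℝ, 0 < L ∧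
    (∀ ε : ℝ, 0 < ε → ∃ C : ℝ, 0 < C ∧ ∀ (n : ℕ) (θ : ℝ),
      |amDet lam ω E n θ| ≤ C * Real.exp ((L + ε) * n)) ∧
    ∀ n : ℕ, ∃ k : ℕ, k ≤ n ∧ n ≤ k + 2 ∧ ∃ θ : ℝ,
      Real.exp (L * n) ≤ 4 * |amDet lam ω E k θ| := by
  have hl : 1 < |lam| / 2 := by
    rw [abs_of_pos (by linarith)]
    linarith
  have l0 : ∀ n, amSup lam ω E n ≤ amSupMax lam ω E n := fun n => le_max_left _ _
  have hpow : ∀ n, (|lam| / 2) ^ n ≤ amSupMax lam ω E n :=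
    fun n => (pow_le_amSup lam ω E n).trans (l0 n)
  have hpos : ∀ n, 0 < amSupMax lam ω E n := fun n => lt_of_lt_of_le (by positivity) (hpow n)
  set a : ℕ → ℝ := fun n => Real.log (2 * amSupMax lam ω E n) with ha
  have hsub : Subadditive a := by
    intro m n
    simp only [ha]
    rw [← Real.log_mul (by linarith [hpos m]) (by linarith [hpos n])]
    refine Real.log_le_log (by linarith [hpos (m + n)]) ?_
    linarith [amSupMax_add_le lam ω E m n]
  have hlow : ∀ n : ℕ, n * Real.log (|lam| / 2) ≤ a n := by
    intro n
    rw [← Real.log_pow]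
    exact Real.log_le_log (by positivity) (by linarith [hpow n, hpos n])
  have hlog : 0 < Real.log (|lam| / 2) := Real.log_pos hl
  have hbdd : BddBelow (Set.range fun n => a n / n) := by
    refine ⟨0, ?_⟩
    rintro _ ⟨n, rfl⟩
    exact div_nonneg ((by positivity : 0 ≤ n * Real.log (|lam| / 2)).trans (hlow n))
      (Nat.cast_nonneg n)
  have htend := hsub.tendsto_lim hbdd
  refine ⟨hsub.lim, ?_, fun ε hε => ?_, fun n => ?_⟩
  · refine hlog.trans_le (ge_of_tendsto htend ?_)
    filter_upwards [eventually_gt_atTop 0] with n hn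
    rw [le_div_iff₀ (by positivity), mul_comm]
    exact hlow n
  · have hev : ∀ᶠ n : ℕ in atTop, a n ≤ (hsub.lim + ε) * n := by
      filter_upwards [htend.eventually_lt_const (lt_add_of_pos_right _ hε),
        eventually_gt_atTop 0] with n hn hn0
      rw [div_lt_iff₀ (by positivity)] at hn
      exact hn.le
    obtain ⟨N, hN⟩ := eventually_atTop.1 hev
    refine ⟨1 + ∑ i ∈ Finset.range N, amSupMax lam ω E i * Real.exp (-((hsub.lim + ε) * i)),
      add_pos_of_pos_of_nonneg one_pos (Finset.sum_nonneg fun i _ =>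
        mul_nonneg (hpos i).le (Real.exp_nonneg _)), fun n θ => ?_⟩
    refine ((abs_amDet_le_amSup lam ω E n θ).trans (l0 n)).trans ?_
    have hnn : ∀ i, 0 ≤ amSupMax lam ω E i * Real.exp (-((hsub.lim + ε) * i)) :=
      fun i => mul_nonneg (hpos i).le (Real.exp_nonneg _)
    rcases lt_or_ge n N with h | h
    · have hle := Finset.single_le_sum (f := fun i : ℕ =>
        amSupMax lam ω E i * Real.exp (-((hsub.lim + ε) * i))) (fun i _ => hnn i)
        (Finset.mem_range.2 h)
      calc amSupMax lam ω E n = amSupMax lam ω E n * Real.exp (-((hsub.lim + ε) * n)) *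
            Real.exp ((hsub.lim + ε) * n) := by
            rw [mul_assoc, ← Real.exp_add, neg_add_cancel, Real.exp_zero, mul_one]
        _ ≤ _ := mul_le_mul_of_nonneg_right (by linarith) (Real.exp_nonneg _)
    · have h1 := hN n h
      simp only [ha] at h1
      rw [Real.log_le_iff_le_exp (by linarith [hpos n])] at h1
      have h2 := Finset.sum_nonneg (s := Finset.range N) fun i _ => hnn i
      nlinarith [Real.exp_pos ((hsub.lim + ε) * n), hpos n]
  · have h1 : Real.exp (hsub.lim * n) ≤ 2 * amSupMax lam ω E n := by
      rcases Nat.eq_zero_or_pos n with rfl | hn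
      · simp [amSupMax, amSup_zero]
      · have h2 := hsub.lim_le_div hbdd hn.ne'
        rw [le_div_iff₀ (by positivity)] at h2
        rwa [← Real.le_log_iff_exp_le (by linarith [hpos n])]
    have h3 : ∃ k ≤ n, n ≤ k + 2 ∧ amSupMax lam ω E n = amSup lam ω E k := by
      rcases max_choice (amSup lam ω E n) (max (amSup lam ω E (n - 1)) (amSup lam ω E (n - 2)))
        with h | h
      · exact ⟨n, le_rfl, by omega, h⟩
      · rcases max_choice (amSup lam ω E (n - 1)) (amSup lam ω E (n - 2)) with h' | h'
        · exact ⟨n - 1, by omega, by omega, h.trans h'⟩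
        · exact ⟨n - 2, by omega, by omega, h.trans h'⟩
    obtain ⟨k, hk1, hk2, hk⟩ := h3
    refine ⟨k, hk1, hk2, ?_⟩
    have h4 : amSupMax lam ω E n / 2 < amSup lam ω E k := by linarith [hpos n]
    obtain ⟨θ, hθ⟩ := exists_lt_of_lt_ciSup h4
    exact ⟨θ, by linarith⟩

end Growth

section Equidistribution

/-- Ergodic sums of a continuous function over an irrational rotation of the circle depend on the
starting point only up to an error that is sublinear in the length, uniformly. -/
theorem irrational_ergodic_sums_sub_le {ω : ℝ} (hω : Irrational ω) (f : C(AddCircle (1 : ℝ), ℂ))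
    {ε : ℝ} (hε : 0 < ε) : ∃ C : ℝ, 0 ≤ C ∧ ∀ (N : ℕ) (x x' : ℝ),
      ‖∑ n ∈ Finset.range N, f ((x + n * ω : ℝ) : AddCircle (1 : ℝ)) -
        ∑ n ∈ Finset.range N, f ((x' + n * ω : ℝ) : AddCircle (1 : ℝ))‖ ≤ ε * N + C := by
  have hspan : ∀ h ∈ Submodule.span ℂ (Set.range (@fourier 1)), ∃ C : ℝ, 0 ≤ C ∧
      ∀ (N : ℕ) (x x' : ℝ),
      ‖∑ n ∈ Finset.range N, h ((x + n * ω : ℝ) : AddCircle (1 : ℝ)) -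
        ∑ n ∈ Finset.range N, h ((x' + n * ω : ℝ) : AddCircle (1 : ℝ))‖ ≤ C := by
    intro h hh
    induction hh using Submodule.span_induction with
    | mem h hh =>
      obtain ⟨k, rfl⟩ := hh
      set q : ℂ := fourier k ((ω : ℝ) : AddCircle (1 : ℝ)) with hq
      have hsum : ∀ (x : ℝ) (n : ℕ), fourier k ((x + n * ω : ℝ) : AddCircle (1 : ℝ)) =
          fourier k ((x : ℝ) : AddCircle (1 : ℝ)) * q ^ n := by
        intro x n
        simp only [hq, fourier_coe_apply]
        rw [← Complex.exp_nat_mul, ← Complex.exp_add]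
        congr 1
        push_cast
        ring
      have hnorm : ∀ z : AddCircle (1 : ℝ), ‖fourier k z‖ = 1 := fun z => by
        rw [fourier_apply]; exact Circle.norm_coe _
      have hqn : ‖q‖ = 1 := hnorm _
      rcases eq_or_ne k 0 with rfl | hk
      · exact ⟨0, le_rfl, fun N x x' => by simp⟩
      · have hq1 : q ≠ 1 := by
          intro h1
          rw [hq, fourier_coe_apply, Complex.exp_eq_one_iff] at h1
          obtain ⟨n, hn⟩ := h1
          have h2 : (k : ℂ) * ω = n := by
            have h3 : (2 * Real.pi * Complex.I : ℂ) ≠ 0 := Complex.two_pi_I_ne_zero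
            apply mul_right_cancel₀ h3
            rw [← hn]
            push_cast
            ring
          have h3 : (k : ℝ) * ω = n := by exact_mod_cast h2
          have h4 := (hω.intCast_mul hk).ne_int n
          exact h4 h3
        have hq0 : 0 < ‖q - 1‖ := norm_pos_iff.2 (sub_ne_zero.2 hq1)
        have hb : ∀ (N : ℕ) (x : ℝ), ‖∑ n ∈ Finset.range N,
            fourier k ((x + n * ω : ℝ) : AddCircle (1 : ℝ))‖ ≤ 2 / ‖q - 1‖ := by
          intro N x
          simp only [hsum]
          rw [← Finset.mul_sum, norm_mul, hnorm, one_mul, geom_sum_eq hq1, norm_div]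
          gcongr
          refine (norm_sub_le _ _).trans ?_
          rw [norm_pow, hqn, one_pow, norm_one]
          norm_num
        refine ⟨2 / ‖q - 1‖ + 2 / ‖q - 1‖, by positivity, fun N x x' => ?_⟩
        exact (norm_sub_le _ _).trans (add_le_add (hb N x) (hb N x'))
    | zero => exact ⟨0, le_rfl, fun N x x' => by simp⟩
    | add f g _ _ hf hg =>
      obtain ⟨C1, hC1, h1⟩ := hf
      obtain ⟨C2, hC2, h2⟩ := hg
      refine ⟨C1 + C2, by positivity, fun N x x' => ?_⟩
      simp only [ContinuousMap.add_apply, Finset.sum_add_distrib]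
      rw [add_sub_add_comm]
      exact (norm_add_le _ _).trans (add_le_add (h1 N x x') (h2 N x x'))
    | smul a f _ hf =>
      obtain ⟨C1, hC1, h1⟩ := hf
      refine ⟨‖a‖ * C1, by positivity, fun N x x' => ?_⟩
      simp only [ContinuousMap.smul_apply, ← Finset.smul_sum]
      rw [← smul_sub, norm_smul]
      exact mul_le_mul_of_nonneg_left (h1 N x x') (norm_nonneg _)
  have hmem : f ∈ (Submodule.span ℂ (Set.range (@fourier 1))).topologicalClosure := by
    rw [span_fourier_closure_eq_top]
    trivial
  obtain ⟨h, hh, hd⟩ := Metric.mem_closure_iff.1 hmem (ε / 2) (by positivity)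
  obtain ⟨C, hC, hb⟩ := hspan h hh
  refine ⟨C, hC, fun N x x' => ?_⟩
  have happ : ∀ x : ℝ, ‖∑ n ∈ Finset.range N, f ((x + n * ω : ℝ) : AddCircle (1 : ℝ)) -
      ∑ n ∈ Finset.range N, h ((x + n * ω : ℝ) : AddCircle (1 : ℝ))‖ ≤ ε / 2 * N := by
    intro x
    rw [← Finset.sum_sub_distrib]
    refine (norm_sum_le_of_le (n := fun _ => ε / 2) _ (fun n _ => ?_)).trans (le_of_eq ?_)
    · rw [← ContinuousMap.sub_apply]
      exact (ContinuousMap.norm_coe_le_norm _ _).trans (by rw [← dist_eq_norm]; exact hd.le)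
    · rw [Finset.sum_const, Finset.card_range, nsmul_eq_mul, mul_comm]
  have h1 := happ x
  have h2 := happ x'
  rw [norm_sub_rev] at h2
  set a := ∑ n ∈ Finset.range N, f ((x + n * ω : ℝ) : AddCircle (1 : ℝ))
  set a' := ∑ n ∈ Finset.range N, f ((x' + n * ω : ℝ) : AddCircle (1 : ℝ))
  set b := ∑ n ∈ Finset.range N, h ((x + n * ω : ℝ) : AddCircle (1 : ℝ))
  set b' := ∑ n ∈ Finset.range N, h ((x' + n * ω : ℝ) : AddCircle (1 : ℝ))
  have e : a - a' = (a - b) + (b - b') + (b' - a') := by ring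
  rw [e]
  refine (norm_add₃_le).trans ?_
  linarith [hb N x x']

theorem irrational_periodic_sums_sub_le {ω : ℝ} (hω : Irrational ω) {g : ℝ → ℝ}
    (hg : Continuous g) (hp : Function.Periodic g 1) {ε : ℝ} (hε : 0 < ε) :
    ∃ C : ℝ, 0 ≤ C ∧ ∀ (N : ℕ) (x x' : ℝ),
      ∑ n ∈ Finset.range N, g (x + n * ω) - ∑ n ∈ Finset.range N, g (x' + n * ω) ≤
        ε * N + C := by
  let f : C(AddCircle (1 : ℝ), ℂ) := ⟨fun z => ((hp.lift z : ℝ) : ℂ),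
    Complex.continuous_ofReal.comp (continuous_quot_lift _ hg)⟩
  have hf : ∀ x : ℝ, f (x : AddCircle (1 : ℝ)) = (g x : ℂ) := fun x => rfl
  obtain ⟨C, hC, h⟩ := irrational_ergodic_sums_sub_le hω f hε
  refine ⟨C, hC, fun N x x' => ?_⟩
  have h1 := h N x x'
  simp only [hf] at h1
  rw [← Complex.ofReal_sum, ← Complex.ofReal_sum, ← Complex.ofReal_sub, Complex.norm_real] at h1
  exact (le_abs_self _).trans h1

end Equidistribution

section SmallDivisors

theorem abs_sin_sub_le (x y : ℝ) : |Real.sin (x - y)| ≤ |Real.sin x| + |Real.sin y| := by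
  rw [Real.sin_sub]
  refine (abs_sub _ _).trans (add_le_add ?_ ?_) <;> rw [abs_mul]
  · exact mul_le_of_le_one_right (abs_nonneg _) (Real.abs_cos_le_one _)
  · exact mul_le_of_le_one_left (abs_nonneg _) (Real.abs_cos_le_one _)

theorem two_mul_abs_sub_round_le (x : ℝ) : 2 * |x - round x| ≤ |Real.sin (Real.pi * x)| := by
  have h := Real.mul_abs_le_abs_sin (x := Real.pi * (x - round x)) (by
    rw [abs_mul, abs_of_pos Real.pi_pos, div_eq_mul_one_div]
    exact mul_le_mul_of_nonneg_left (abs_sub_round x) Real.pi_pos.le)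
  rw [abs_mul, abs_of_pos Real.pi_pos, ← mul_assoc, div_mul_cancel₀ _ Real.pi_ne_zero,
    mul_sub, mul_comm Real.pi (round x : ℝ), Real.sin_sub_int_mul_pi, abs_mul] at h
  simpa using h

variable {ω c R γ : ℝ}

/-- In a dyadic block of an orbit of a Diophantine rotation, the sum of a small negative power of
the small divisors is linear in the length once the smallest divisor is omitted. -/
theorem sum_sin_rpow_dyadic (hc : 0 < c)
    (hd : ∀ n : ℤ, n ≠ 0 → c * (1 + |(n : ℝ)|) ^ (-R) ≤ |Real.sin (Real.pi * (n * ω))|)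
    (hR : 0 ≤ R) (hγ : 0 < γ) (hγR : (2 : ℝ) ^ (γ * R) ≤ 3 / 2) (i : ℕ) (x : ℝ) :
    ∃ n₀ : ℕ, n₀ < 2 ^ i ∧ (∀ n : ℕ, n < 2 ^ i → |Real.sin (Real.pi * (x + n₀ * ω))| ≤
        |Real.sin (Real.pi * (x + n * ω))|) ∧
      ∑ n ∈ Finset.range (2 ^ i), |Real.sin (Real.pi * (x + n * ω))| ^ (-γ) -
        |Real.sin (Real.pi * (x + n₀ * ω))| ^ (-γ) ≤
          3 * (c / 2) ^ (-γ) * (2 ^ i - (3 / 2) ^ i) := by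
  have hA : 0 < (c / 2) ^ (-γ) := Real.rpow_pos_of_pos (by positivity) _
  have hfar : ∀ (i : ℕ) (x : ℝ) (m m' : ℕ), m < 2 ^ i → m' < 2 ^ i → m ≠ m' →
      |Real.sin (Real.pi * (x + m * ω))| ≤ |Real.sin (Real.pi * (x + m' * ω))| →
      |Real.sin (Real.pi * (x + m' * ω))| ^ (-γ) ≤ (c / 2) ^ (-γ) * (3 / 2) ^ i := by
    intro i x m m' hm hm' hne hle
    have h1 := hd (m' - m) (by omega)
    have h2 := abs_sin_sub_le (Real.pi * (x + m' * ω)) (Real.pi * (x + m * ω))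
    rw [show Real.pi * (x + m' * ω) - Real.pi * (x + m * ω) =
      Real.pi * (((m' - m : ℤ) : ℝ) * ω) by push_cast; ring] at h2
    have h3 : 1 + |((m' - m : ℤ) : ℝ)| ≤ (2 : ℝ) ^ i := by
      have : 1 + |(m' - m : ℤ)| ≤ 2 ^ i := by
        have a1 : (m : ℤ) < 2 ^ i := by exact_mod_cast hm
        have a2 : (m' : ℤ) < 2 ^ i := by exact_mod_cast hm'
        have : |(m' - m : ℤ)| < 2 ^ i := abs_lt.2 ⟨by omega, by omega⟩
        omega
      exact_mod_cast this
    have h4 : ((2 : ℝ) ^ i) ^ (-R) ≤ (1 + |((m' - m : ℤ) : ℝ)|) ^ (-R) :=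
      Real.rpow_le_rpow_of_nonpos (by positivity) h3 (by linarith)
    have h5 : c / 2 * ((2 : ℝ) ^ i) ^ (-R) ≤ |Real.sin (Real.pi * (x + m' * ω))| := by
      have := mul_le_mul_of_nonneg_left h4 hc.le
      linarith
    refine (Real.rpow_le_rpow_of_nonpos (by positivity) h5 (by linarith)).trans ?_
    rw [Real.mul_rpow (by positivity) (by positivity), ← Real.rpow_mul (by positivity),
      ← Real.rpow_natCast 2 i, ← Real.rpow_mul (by positivity),
      show (i : ℝ) * (-R * -γ) = (γ * R) * i by ring, Real.rpow_mul (by positivity),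
      Real.rpow_natCast]
    gcongr
  induction i generalizing x with
  | zero => exact ⟨0, by simp, fun n hn => by simp at hn; simp [hn], by simp⟩
  | succ i ih =>
    obtain ⟨n₁, hn₁, hm₁, hs₁⟩ := ih x
    obtain ⟨n₂, hn₂, hm₂, hs₂⟩ := ih (x + (2 ^ i : ℕ) * ω)
    have hsh : ∀ n : ℕ, x + (2 ^ i : ℕ) * ω + n * ω = x + ((2 ^ i + n : ℕ) : ℝ) * ω := by
      intro n; push_cast; ring
    simp only [hsh] at hm₂ hs₂
    have hsplit : ∑ n ∈ Finset.range (2 ^ (i + 1)), |Real.sin (Real.pi * (x + n * ω))| ^ (-γ) =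
        ∑ n ∈ Finset.range (2 ^ i), |Real.sin (Real.pi * (x + n * ω))| ^ (-γ) +
        ∑ n ∈ Finset.range (2 ^ i),
          |Real.sin (Real.pi * (x + ((2 ^ i + n : ℕ) : ℝ) * ω))| ^ (-γ) := by
      rw [pow_succ, mul_two, Finset.sum_range_add]
    have hmin : ∀ n : ℕ, n < 2 ^ (i + 1) →
        |Real.sin (Real.pi * (x + n₁ * ω))| ≤ |Real.sin (Real.pi * (x + n * ω))| ∨
        |Real.sin (Real.pi * (x + ((2 ^ i + n₂ : ℕ) : ℝ) * ω))| ≤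
          |Real.sin (Real.pi * (x + n * ω))| := by
      intro n hn
      rcases lt_or_ge n (2 ^ i) with h | h
      · exact Or.inl (hm₁ n h)
      · have h' := hm₂ (n - 2 ^ i) (by rw [pow_succ] at hn; omega)
        rw [show 2 ^ i + (n - 2 ^ i) = n by omega] at h'
        exact Or.inr h'
    have hlt₁ : n₁ < 2 ^ (i + 1) := by rw [pow_succ]; omega
    have hlt₂ : 2 ^ i + n₂ < 2 ^ (i + 1) := by rw [pow_succ]; omega
    have hnum : (3 : ℝ) * (c / 2) ^ (-γ) * (2 ^ i - (3 / 2) ^ i) +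
        3 * (c / 2) ^ (-γ) * (2 ^ i - (3 / 2) ^ i) + (c / 2) ^ (-γ) * (3 / 2) ^ (i + 1) =
        3 * (c / 2) ^ (-γ) * (2 ^ (i + 1) - (3 / 2) ^ (i + 1)) := by ring
    rcases le_total (|Real.sin (Real.pi * (x + n₁ * ω))|)
      (|Real.sin (Real.pi * (x + ((2 ^ i + n₂ : ℕ) : ℝ) * ω))|) with h | h
    · refine ⟨n₁, hlt₁, fun n hn => (hmin n hn).elim id h.trans, ?_⟩
      have := hfar (i + 1) x n₁ (2 ^ i + n₂) hlt₁ hlt₂ (by omega) h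
      rw [hsplit]
      linarith
    · refine ⟨2 ^ i + n₂, hlt₂, fun n hn => (hmin n hn).elim h.trans id, ?_⟩
      have := hfar (i + 1) x (2 ^ i + n₂) n₁ hlt₂ hlt₁ (by omega) h
      rw [hsplit]
      linarith

theorem sum_sin_rpow_le (hc : 0 < c)
    (hd : ∀ n : ℤ, n ≠ 0 → c * (1 + |(n : ℝ)|) ^ (-R) ≤ |Real.sin (Real.pi * (n * ω))|)
    (hR : 0 ≤ R) (hγ : 0 < γ) (hγR : (2 : ℝ) ^ (γ * R) ≤ 3 / 2) (N : ℕ) (x : ℝ)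
    (S : Finset ℕ) (hS : S ⊆ Finset.range N) {s : ℝ} (hs : 0 < s)
    (hsS : ∀ n ∈ S, s ≤ |Real.sin (Real.pi * (x + n * ω))|) :
    ∑ n ∈ S, |Real.sin (Real.pi * (x + n * ω))| ^ (-γ) ≤
      6 * (c / 2) ^ (-γ) * N + s ^ (-γ) := by
  have hA : 0 < (c / 2) ^ (-γ) := Real.rpow_pos_of_pos (by positivity) _
  have hs' : 0 < s ^ (-γ) := Real.rpow_pos_of_pos hs _
  rcases Nat.eq_zero_or_pos N with rfl | hN
  · simp only [Finset.range_zero, Finset.subset_empty] at hS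
    simp [hS, hs'.le]
  set i := Nat.log 2 N + 1 with hi
  have hN1 : N ≤ 2 ^ i := (Nat.lt_pow_succ_log_self one_lt_two N).le
  have hN2 : 2 ^ i ≤ 2 * N := by
    rw [hi, pow_succ, mul_comm]
    exact Nat.mul_le_mul_left 2 (Nat.pow_log_le_self 2 hN.ne')
  have hN2' : (2 : ℝ) ^ i ≤ 2 * N := by exact_mod_cast hN2
  obtain ⟨n₀, hn₀, -, hsum⟩ := sum_sin_rpow_dyadic hc hd hR hγ hγR i x
  have hS' : S ⊆ Finset.range (2 ^ i) := hS.trans (Finset.range_mono hN1)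
  have hnn : ∀ n, 0 ≤ |Real.sin (Real.pi * (x + (n : ℕ) * ω))| ^ (-γ) :=
    fun n => Real.rpow_nonneg (abs_nonneg _) _
  have hmain : ∑ n ∈ Finset.range (2 ^ i), |Real.sin (Real.pi * (x + n * ω))| ^ (-γ) -
        |Real.sin (Real.pi * (x + n₀ * ω))| ^ (-γ) ≤ 6 * (c / 2) ^ (-γ) * N := by
    refine hsum.trans ?_
    have : (0 : ℝ) < (3 / 2) ^ i := by positivity
    nlinarith
  have herase : ∑ n ∈ S.erase n₀, |Real.sin (Real.pi * (x + n * ω))| ^ (-γ) ≤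
      6 * (c / 2) ^ (-γ) * N := by
    refine le_trans ?_ hmain
    rw [← Finset.sum_erase_eq_sub (Finset.mem_range.2 hn₀)]
    exact Finset.sum_le_sum_of_subset_of_nonneg (Finset.erase_subset_erase _ hS')
      fun n _ _ => hnn n
  by_cases h : n₀ ∈ S
  · rw [← Finset.sum_erase_add _ _ h]
    exact add_le_add herase (Real.rpow_le_rpow_of_nonpos hs (hsS _ h) (by linarith))
  · rw [Finset.erase_eq_of_notMem h] at herase
    linarith

end SmallDivisors

section ProductComparison

theorem log_one_add_div_sq_le {γ δ s : ℝ} (hγ : 0 < γ) (hγ2 : γ ≤ 2) (hδ : 0 < δ) (hs : 0 < s) :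
    Real.log (1 + δ / s ^ 2) ≤ 2 / γ * δ ^ (γ / 2) * s ^ (-γ) := by
  have hz : 0 < δ / s ^ 2 := by positivity
  have h1 : (1 + δ / s ^ 2) ^ (γ / 2) ≤ 1 ^ (γ / 2) + (δ / s ^ 2) ^ (γ / 2) :=
    Real.rpow_add_le_add_rpow zero_le_one hz.le (by positivity) (by linarith)
  rw [Real.one_rpow] at h1
  have h2 := Real.log_le_sub_one_of_pos (x := (1 + δ / s ^ 2) ^ (γ / 2)) (by positivity)
  rw [Real.log_rpow (by positivity)] at h2
  have h3 : (δ / s ^ 2) ^ (γ / 2) = δ ^ (γ / 2) * s ^ (-γ) := by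
    rw [Real.div_rpow hδ.le (by positivity), ← Real.rpow_natCast s 2, ← Real.rpow_mul hs.le,
      Real.rpow_neg hs.le, div_eq_mul_inv]
    congr 3
    push_cast
    ring
  rw [mul_assoc, ← h3, div_mul_eq_mul_div, le_div_iff₀ hγ]
  linarith

variable {ω c R γ : ℝ}

/-- Comparison of the products of small divisors along two orbit segments of equal length. -/
theorem prod_sin_le_exp_mul_prod_sin (hω : Irrational ω) (hc : 0 < c)
    (hd : ∀ n : ℤ, n ≠ 0 → c * (1 + |(n : ℝ)|) ^ (-R) ≤ |Real.sin (Real.pi * (n * ω))|)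
    (hR : 0 ≤ R) (hγ : 0 < γ) (hγ2 : γ ≤ 2) (hγR : (2 : ℝ) ^ (γ * R) ≤ 3 / 2)
    {ε : ℝ} (hε : 0 < ε) : ∃ B : ℝ, 0 < B ∧ ∀ (m : ℕ) (x x' : ℝ) (S : Finset ℕ),
      S ⊆ Finset.range m → (Finset.range m \ S).card ≤ 1 → ∀ s : ℝ, 0 < s →
      (∀ n ∈ S, s ≤ |Real.sin (Real.pi * (x' + n * ω))|) →
      ∏ n ∈ S, |Real.sin (Real.pi * (x + n * ω))| ≤
        Real.exp (ε * m + B + B * s ^ (-γ)) * ∏ n ∈ S, |Real.sin (Real.pi * (x' + n * ω))| := by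
  set K := 6 * (c / 2) ^ (-γ) with hK
  have hK0 : 0 < K := mul_pos (by norm_num) (Real.rpow_pos_of_pos (by positivity) _)
  obtain ⟨δ, hδ, hδε⟩ : ∃ δ : ℝ, 0 < δ ∧ 1 / γ * δ ^ (γ / 2) * K ≤ ε / 2 := by
    refine ⟨(ε / 2 * γ / K) ^ (2 / γ), Real.rpow_pos_of_pos (by positivity) _, ?_⟩
    rw [← Real.rpow_mul (by positivity), div_mul_div_comm, mul_comm 2 γ, div_self (by positivity),
      Real.rpow_one]
    apply le_of_eq
    field_simp
  set g : ℝ → ℝ := fun x => 1 / 2 * Real.log (Real.sin (Real.pi * x) ^ 2 + δ) with hg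
  have hgpos : ∀ x, 0 < Real.sin (Real.pi * x) ^ 2 + δ := fun x => by positivity
  have hgc : Continuous g := by
    refine continuous_const.mul (Continuous.log (by fun_prop) fun x => (hgpos x).ne')
  have hgp : Function.Periodic g 1 := by
    intro x
    simp only [hg]
    rw [mul_add, mul_one, Real.sin_add_pi, neg_sq]
  set M := |Real.log δ| + |Real.log (1 + δ)| with hM
  have hgM : ∀ x, |g x| ≤ M := by
    intro x
    have h1 : Real.log δ ≤ Real.log (Real.sin (Real.pi * x) ^ 2 + δ) :=
      Real.log_le_log hδ (by nlinarith [sq_nonneg (Real.sin (Real.pi * x))])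
    have h2 : Real.log (Real.sin (Real.pi * x) ^ 2 + δ) ≤ Real.log (1 + δ) :=
      Real.log_le_log (hgpos x) (by linarith [Real.sin_sq_le_one (Real.pi * x)])
    have h3 := neg_abs_le (Real.log δ)
    have h4 := le_abs_self (Real.log (1 + δ))
    simp only [hg]
    rw [abs_le]
    constructor <;> linarith [abs_nonneg (Real.log δ), abs_nonneg (Real.log (1 + δ))]
  obtain ⟨C, hC, hsum⟩ := irrational_periodic_sums_sub_le hω hgc hgp (half_pos hε)
  refine ⟨C + 2 * M + 1 / γ * δ ^ (γ / 2), by positivity, fun m x x' S hS hcard s hs hsS => ?_⟩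
  set B := C + 2 * M + 1 / γ * δ ^ (γ / 2) with hB
  have hM0 : 0 ≤ M := by positivity
  have hupper : ∏ n ∈ S, |Real.sin (Real.pi * (x + n * ω))| ≤
      Real.exp (∑ n ∈ S, g (x + n * ω)) := by
    rw [Real.exp_sum]
    refine Finset.prod_le_prod (fun _ _ => abs_nonneg _) fun n _ => ?_
    simp only [hg]
    rw [mul_comm (1 / 2 : ℝ), Real.exp_mul, Real.exp_log (hgpos _), ← Real.sqrt_eq_rpow]
    exact Real.abs_le_sqrt (by linarith)
  have hlower : ∏ n ∈ S, |Real.sin (Real.pi * (x' + n * ω))| =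
      Real.exp (∑ n ∈ S, g (x' + n * ω) - ∑ n ∈ S,
        1 / 2 * Real.log (1 + δ / |Real.sin (Real.pi * (x' + n * ω))| ^ 2)) := by
    rw [← Finset.sum_sub_distrib, Real.exp_sum]
    refine Finset.prod_congr rfl fun n hn => ?_
    have hpos := hs.trans_le (hsS n hn)
    simp only [hg]
    rw [← mul_sub, ← Real.log_div (hgpos _).ne' (by positivity), ← sq_abs]
    have e : (|Real.sin (Real.pi * (x' + n * ω))| ^ 2 + δ) /
        (1 + δ / |Real.sin (Real.pi * (x' + n * ω))| ^ 2) =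
        |Real.sin (Real.pi * (x' + n * ω))| ^ 2 := by
      field_simp
    rw [e, Real.log_pow]
    push_cast
    rw [← mul_assoc, one_div_mul_cancel (by norm_num), one_mul, Real.exp_log hpos]
  have hrest : ∀ z : ℝ, |∑ n ∈ Finset.range m, g (z + n * ω) - ∑ n ∈ S, g (z + n * ω)| ≤ M := by
    intro z
    rw [← Finset.sum_sdiff hS, add_sub_cancel_right]
    refine (Finset.abs_sum_le_sum_abs _ _).trans
      ((Finset.sum_le_card_nsmul _ _ M fun n _ => hgM _).trans ?_)
    rw [nsmul_eq_mul]
    exact mul_le_of_le_one_left hM0 (by exact_mod_cast hcard)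
  have htail : ∑ n ∈ S, 1 / 2 * Real.log (1 + δ / |Real.sin (Real.pi * (x' + n * ω))| ^ 2) ≤
      1 / γ * δ ^ (γ / 2) * (K * m + s ^ (-γ)) := by
    calc _ ≤ ∑ n ∈ S, 1 / γ * δ ^ (γ / 2) * |Real.sin (Real.pi * (x' + n * ω))| ^ (-γ) := by
          refine Finset.sum_le_sum fun n hn => ?_
          have := log_one_add_div_sq_le hγ hγ2 hδ (hs.trans_le (hsS n hn))
          calc _ ≤ 1 / 2 * (2 / γ * δ ^ (γ / 2) *
                |Real.sin (Real.pi * (x' + n * ω))| ^ (-γ)) := by gcongr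
            _ = _ := by ring
      _ ≤ _ := by
          rw [← Finset.mul_sum]
          exact mul_le_mul_of_nonneg_left
            (sum_sin_rpow_le hc hd hR hγ hγR m x' S hS hs hsS) (by positivity)
  rw [hlower, ← Real.exp_add]
  refine hupper.trans (Real.exp_le_exp.2 ?_)
  have a1 := abs_le.1 (hrest x)
  have a2 := abs_le.1 (hrest x')
  have a3 := hsum m x x'
  have hs' : 0 < s ^ (-γ) := Real.rpow_pos_of_pos hs _
  have a4 : 1 / γ * δ ^ (γ / 2) * (K * m) ≤ ε / 2 * m := by
    rw [← mul_assoc]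
    exact mul_le_mul_of_nonneg_right hδε (Nat.cast_nonneg m)
  have a5 : 1 / γ * δ ^ (γ / 2) * s ^ (-γ) ≤ B * s ^ (-γ) :=
    mul_le_mul_of_nonneg_right (by rw [hB]; linarith) hs'.le
  have a6 : 0 < 1 / γ * δ ^ (γ / 2) := by positivity
  have a7 : C + 2 * M ≤ B := by rw [hB]; linarith
  rw [mul_add] at htail
  linarith [a1.1, a2.2]

end ProductComparison

section Nodes

variable {ω θ c R : ℝ}

theorem abs_cos_sub_cos (β α : ℝ) : |Real.cos (2 * Real.pi * β) - Real.cos (2 * Real.pi * α)| =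
    2 * (|Real.sin (Real.pi * (α + β))| * |Real.sin (Real.pi * (α - β))|) := by
  rw [Real.cos_sub_cos, abs_mul, abs_mul]
  rw [show (2 * Real.pi * β + 2 * Real.pi * α) / 2 = Real.pi * (α + β) by ring,
    show (2 * Real.pi * β - 2 * Real.pi * α) / 2 = -(Real.pi * (α - β)) by ring, Real.sin_neg]
  simp [mul_assoc]

/-- Comparison of node polynomials over one block of sites. -/
theorem prod_cos_sub_cos_le (hω : Irrational ω) (hc : 0 < c) (hR : 1 ≤ R)
    (hd : ∀ n : ℤ, n ≠ 0 → c * (1 + |(n : ℝ)|) ^ (-R) ≤ |Real.sin (Real.pi * (n * ω))|)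
    (hθ : ∀ n : ℤ, c * (1 + |(n : ℝ)|) ^ (-R) ≤ |Real.sin (Real.pi * (2 * θ + n * ω))|)
    {ε : ℝ} (hε : 0 < ε) : ∀ᶠ k : ℕ in atTop, ∀ (m : ℕ) (a j : ℤ), m ≤ k → |a| ≤ 3 * k →
      |j| ≤ 3 * k → ∀ β : ℝ, ∏ l ∈ (Finset.Ico a (a + m)).erase j,
        |Real.cos (2 * Real.pi * β) -
          Real.cos (2 * Real.pi * (θ + (l + ((k : ℝ) - 1) / 2) * ω))| ≤
      Real.exp (ε * k) * ∏ l ∈ (Finset.Ico a (a + m)).erase j,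
        |Real.cos (2 * Real.pi * (θ + (j + ((k : ℝ) - 1) / 2) * ω)) -
          Real.cos (2 * Real.pi * (θ + (l + ((k : ℝ) - 1) / 2) * ω))| := by
  have hR0 : 0 < R := by linarith
  set γ := 1 / (2 * R) with hγdef
  have hγ : 0 < γ := by positivity
  have hγ2 : γ ≤ 2 := by
    rw [hγdef, div_le_iff₀ (by positivity)]
    linarith
  have hRγ : γ * R = 1 / 2 := by
    rw [hγdef]
    field_simp
  have hγR : (2 : ℝ) ^ (γ * R) ≤ 3 / 2 := by
    rw [hRγ, ← Real.sqrt_eq_rpow, Real.sqrt_le_left (by norm_num)]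
    norm_num
  obtain ⟨B, hB, hprod⟩ := prod_sin_le_exp_mul_prod_sin hω hc hd hR0.le hγ hγ2 hγR
    (ε := ε / 4) (by positivity)
  have hev : ∀ᶠ k : ℕ in atTop, B + B * (c ^ (-γ) * Real.sqrt (10 * k)) ≤ ε / 4 * k := by
    have h1 : Tendsto (fun k : ℕ => Real.sqrt k) atTop atTop :=
      Real.tendsto_sqrt_atTop.comp tendsto_natCast_atTop_atTop
    set D := B * (c ^ (-γ) * Real.sqrt 10) with hD
    filter_upwards [h1.eventually_ge_atTop ((B + D) / (ε / 4)), h1.eventually_ge_atTop 1]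
      with k hk hk1
    have hs := Real.sq_sqrt (Nat.cast_nonneg (α := ℝ) k)
    rw [div_le_iff₀ (by positivity)] at hk
    rw [Real.sqrt_mul (by norm_num)]
    have e1 : B + B * (c ^ (-γ) * (Real.sqrt 10 * Real.sqrt k)) = B + D * Real.sqrt k := by
      rw [hD]; ring
    rw [e1]
    calc B + D * Real.sqrt k ≤ (B + D) * Real.sqrt k := by nlinarith
      _ ≤ Real.sqrt k * (ε / 4) * Real.sqrt k := by gcongr
      _ = ε / 4 * (Real.sqrt k) ^ 2 := by ring
      _ = _ := by rw [hs]
  filter_upwards [hev, eventually_ge_atTop 1] with k hk hk1 m a j hm ha hj β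
  set α : ℤ → ℝ := fun l => θ + (l + ((k : ℝ) - 1) / 2) * ω with hα
  have hk0 : (0 : ℝ) < 10 * k := by positivity
  set s := c * (10 * (k : ℝ)) ^ (-R) with hs
  have hs0 : 0 < s := mul_pos hc (Real.rpow_pos_of_pos hk0 _)
  have hsγ : s ^ (-γ) = c ^ (-γ) * Real.sqrt (10 * k) := by
    rw [hs, Real.mul_rpow hc.le (Real.rpow_nonneg hk0.le _), ← Real.rpow_mul hk0.le, neg_mul_neg,
      mul_comm R, hRγ, Real.sqrt_eq_rpow]
  set S := (Finset.range m).filter (fun n : ℕ => a + n ≠ j) with hS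
  have hSsub : S ⊆ Finset.range m := Finset.filter_subset _ _
  have hcard : (Finset.range m \ S).card ≤ 1 := by
    rw [Finset.card_le_one]
    intro x hx y hy
    simp only [hS, Finset.mem_sdiff, Finset.mem_filter, not_and, not_not] at hx hy
    have := hx.2 hx.1
    have := hy.2 hy.1
    omega
  have himg : (Finset.Ico a (a + m)).erase j = S.image (fun n : ℕ => a + n) := by
    ext l
    simp only [hS, Finset.mem_erase, Finset.mem_Ico, Finset.mem_image, Finset.mem_filter,
      Finset.mem_range]
    constructor
    · rintro ⟨h1, h2, h3⟩
      exact ⟨(l - a).toNat, by omega, by omega⟩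
    · rintro ⟨n, ⟨h1, h2⟩, rfl⟩
      exact ⟨h2, by omega, by omega⟩
  have hinj : Set.InjOn (fun n : ℕ => a + (n : ℤ)) S := fun x _ y _ h => by
    simpa using h
  have hle : ∀ n : ℤ, |n| ≤ 9 * k → s ≤ c * (1 + |(n : ℝ)|) ^ (-R) := by
    intro n hn
    refine mul_le_mul_of_nonneg_left ?_ hc.le
    refine Real.rpow_le_rpow_of_nonpos (by positivity) ?_ (by linarith)
    have h1 : |(n : ℝ)| ≤ 9 * k := by exact_mod_cast hn
    have h2 : (1 : ℝ) ≤ k := by exact_mod_cast hk1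
    linarith
  have hsplit : ∀ β : ℝ, ∏ l ∈ (Finset.Ico a (a + m)).erase j,
      |Real.cos (2 * Real.pi * β) - Real.cos (2 * Real.pi * (α l))| =
      2 ^ S.card * ((∏ n ∈ S, |Real.sin (Real.pi * ((α a + β) + n * ω))|) *
        ∏ n ∈ S, |Real.sin (Real.pi * ((α a - β) + n * ω))|) := by
    intro β
    rw [himg, Finset.prod_image hinj, ← Finset.prod_mul_distrib, ← Finset.prod_const,
      ← Finset.prod_mul_distrib]
    refine Finset.prod_congr rfl fun n _ => ?_
    rw [abs_cos_sub_cos]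
    congr 5
    · simp only [hα]; push_cast; ring
    · simp only [hα]; push_cast; ring
  have p1 := hprod m (α a + β) (α a + α j) S hSsub hcard s hs0 (fun n hn => by
    have hn' := (Finset.mem_filter.1 hn).1
    rw [Finset.mem_range] at hn'
    refine (hle (a + j + n + k - 1) ?_).trans ((hθ _).trans (le_of_eq ?_))
    · rw [abs_le] at *
      omega
    · congr 3
      simp only [hα]; push_cast; ring)
  have p2 := hprod m (α a - β) (α a - α j) S hSsub hcard s hs0 (fun n hn => by
    have hn' := Finset.mem_filter.1 hn
    rw [Finset.mem_range] at hn'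
    refine (hle (a + n - j) ?_).trans ((hd _ (by omega)).trans (le_of_eq ?_))
    · rw [abs_le] at *
      omega
    · congr 3
      simp only [hα]; push_cast; ring)
  have hm' : (m : ℝ) ≤ k := by exact_mod_cast hm
  have hexp : Real.exp (ε / 4 * m + B + B * s ^ (-γ)) ≤ Real.exp (ε / 2 * k) := by
    rw [hsγ]
    apply Real.exp_le_exp.2
    nlinarith
  rw [show ε * k = ε / 2 * k + ε / 2 * k by ring, Real.exp_add]
  rw [hsplit β, hsplit (α j)]
  have n1 : ∀ z : ℝ, 0 ≤ ∏ n ∈ S, |Real.sin (Real.pi * (z + n * ω))| :=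
    fun z => Finset.prod_nonneg fun _ _ => abs_nonneg _
  have p1' := p1.trans (mul_le_mul_of_nonneg_right hexp (n1 _))
  have p2' := p2.trans (mul_le_mul_of_nonneg_right hexp (n1 _))
  calc _ ≤ 2 ^ S.card *
        ((Real.exp (ε / 2 * k) * ∏ n ∈ S, |Real.sin (Real.pi * ((α a + α j) + n * ω))|) *
        (Real.exp (ε / 2 * k) * ∏ n ∈ S, |Real.sin (Real.pi * ((α a - α j) + n * ω))|)) := by
        refine mul_le_mul_of_nonneg_left (mul_le_mul p1' p2' (n1 _) ?_) (by positivity)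
        exact mul_nonneg (Real.exp_pos _).le (n1 _)
    _ = _ := by ring

theorem cos_nodes_injective (hc : 0 < c)
    (hd : ∀ n : ℤ, n ≠ 0 → c * (1 + |(n : ℝ)|) ^ (-R) ≤ |Real.sin (Real.pi * (n * ω))|)
    (hθ : ∀ n : ℤ, c * (1 + |(n : ℝ)|) ^ (-R) ≤ |Real.sin (Real.pi * (2 * θ + n * ω))|) (k : ℤ) :
    Function.Injective fun l : ℤ =>
      Real.cos (2 * Real.pi * (θ + (l + ((k : ℝ) - 1) / 2) * ω)) := by
  intro l j h
  by_contra hlj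
  have hpos : ∀ n : ℤ, 0 < c * (1 + |(n : ℝ)|) ^ (-R) := fun n =>
    mul_pos hc (Real.rpow_pos_of_pos (by positivity) _)
  have h1 := abs_cos_sub_cos (θ + (l + ((k : ℝ) - 1) / 2) * ω) (θ + (j + ((k : ℝ) - 1) / 2) * ω)
  simp only at h
  rw [h, sub_self, abs_zero] at h1
  have h2 := (hpos _).trans_le (hθ (l + j + k - 1))
  have h3 := (hpos _).trans_le (hd (j - l) (by omega))
  push_cast at h2 h3
  rw [show 2 * θ + ((l : ℝ) + j + k - 1) * ω = θ + (j + ((k : ℝ) - 1) / 2) * ω +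
    (θ + (l + ((k : ℝ) - 1) / 2) * ω) by ring] at h2
  rw [show ((j : ℝ) - l) * ω = θ + (j + ((k : ℝ) - 1) / 2) * ω -
    (θ + (l + ((k : ℝ) - 1) / 2) * ω) by ring] at h3
  nlinarith [mul_pos h2 h3]

open Polynomial in
/-- A polynomial of low degree is controlled by its values at almost uniform nodes. -/
theorem abs_eval_le_of_prod_le {ι : Type*} [DecidableEq ι] {s : Finset ι} {v : ι → ℝ}
    (hv : Set.InjOn v s) {Q : ℝ[X]} (hQ : Q.degree < s.card) {K T t : ℝ}
    (hK : ∀ i ∈ s, ∏ l ∈ s.erase i, |t - v l| ≤ K * ∏ l ∈ s.erase i, |v i - v l|)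
    (hT : ∀ i ∈ s, |Q.eval (v i)| ≤ T) : |Q.eval t| ≤ s.card * (K * T) := by
  rw [Lagrange.eq_interpolate hv hQ, Lagrange.interpolate_apply, eval_finsetSum]
  refine (Finset.abs_sum_le_sum_abs _ _).trans ?_
  rw [← nsmul_eq_mul]
  refine Finset.sum_le_card_nsmul _ _ _ fun i hi => ?_
  rw [eval_mul, eval_C, abs_mul, mul_comm K]
  refine mul_le_mul (hT i hi) ?_ (abs_nonneg _) ((abs_nonneg _).trans (hT i hi))
  have hpos : 0 < ∏ l ∈ s.erase i, |v i - v l| := Finset.prod_pos fun l hl => by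
    rw [abs_pos, sub_ne_zero]
    intro h
    exact (Finset.mem_erase.1 hl).1 (hv (Finset.mem_erase.1 hl).2 hi h.symm)
  rw [Lagrange.basis, eval_prod, Finset.abs_prod]
  refine le_of_mul_le_mul_right ?_ hpos
  refine le_trans (le_of_eq ?_) (hK i hi)
  rw [← Finset.prod_mul_distrib]
  refine Finset.prod_congr rfl fun l hl => ?_
  have hne : v i - v l ≠ 0 := by
    rw [sub_ne_zero]
    intro h
    exact (Finset.mem_erase.1 hl).1 (hv (Finset.mem_erase.1 hl).2 hi h.symm)
  rw [Lagrange.basisDivisor, eval_mul, eval_C, eval_sub, eval_X, eval_C, ← abs_mul]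
  congr 1
  field_simp

/-- The determinants over boxes are uniformly controlled by their values on two blocks of sites. -/
theorem abs_amDet_le_of_blocks (hω : Irrational ω) (hc : 0 < c) (hR : 1 ≤ R)
    (hd : ∀ n : ℤ, n ≠ 0 → c * (1 + |(n : ℝ)|) ^ (-R) ≤ |Real.sin (Real.pi * (n * ω))|)
    (hθ : ∀ n : ℤ, c * (1 + |(n : ℝ)|) ^ (-R) ≤ |Real.sin (Real.pi * (2 * θ + n * ω))|)
    {ε : ℝ} (hε : 0 < ε) : ∀ᶠ k : ℕ in atTop, ∀ (lam E : ℝ) (y : ℤ) (T : ℝ),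
      (k : ℤ) ≤ |y| → |y| ≤ k + 2 →
      (∀ l : ℤ, -(k / 4 + k / 2 : ℕ) ≤ l → l ≤ -(k / 4 : ℕ) →
        |amDet lam ω E k (θ + l * ω)| ≤ T ∧ |amDet lam ω E k (θ + (y + l : ℤ) * ω)| ≤ T) →
      ∀ φ : ℝ, |amDet lam ω E k φ| ≤ Real.exp (ε * k) * T := by
  have hlin : ∀ᶠ k : ℕ in atTop, (k : ℝ) + 2 ≤ Real.exp (ε / 2 * k) := by
    have h0 := (Real.tendsto_exp_div_pow_atTop 1).comp
      ((tendsto_natCast_atTop_atTop (R := ℝ)).const_mul_atTop (half_pos hε))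
    filter_upwards [h0.eventually_ge_atTop (3 / (ε / 2)), eventually_ge_atTop 1] with k hk hk1
    have hk' : (1 : ℝ) ≤ k := by exact_mod_cast hk1
    simp only [Function.comp, pow_one] at hk
    rw [div_le_div_iff₀ (by positivity) (by positivity)] at hk
    have : ε / 2 * (3 * k) ≤ ε / 2 * Real.exp (ε / 2 * k) := by linarith
    have := le_of_mul_le_mul_left this (half_pos hε)
    linarith
  filter_upwards [hlin, prod_cos_sub_cos_le hω hc hR hd hθ (ε := ε / 4) (by positivity),
    eventually_ge_atTop 10] with k hk2 hprod hk10 lam E y T hy1 hy2 hT φ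
  obtain ⟨Q, hQ, hQe⟩ := exists_polynomial_amDet lam ω E k
  set v : ℤ → ℝ := fun l => Real.cos (2 * Real.pi * (θ + (l + ((k : ℝ) - 1) / 2) * ω)) with hv
  have hinj : Function.Injective v := by
    simpa using cos_nodes_injective hc hd hθ (k : ℤ)
  set m := k / 2 + 1 with hm
  set a : ℤ := -(k / 4 + k / 2 : ℕ) with ha
  set I₁ := Finset.Ico a (a + m) with hI₁
  set I₂ := Finset.Ico (y + a) (y + a + m) with hI₂
  have hdisj : Disjoint I₁ I₂ := by
    rw [Finset.disjoint_left]
    intro l h1 h2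
    rw [Finset.mem_Ico] at h1 h2
    rcases abs_cases y with h | h <;> omega
  have hcard : (I₁ ∪ I₂).card = 2 * m := by
    rw [Finset.card_union_of_disjoint hdisj, Int.card_Ico, Int.card_Ico]
    omega
  have hdeg : Q.degree < ((I₁ ∪ I₂).card : ℕ) := by
    rw [hcard]
    refine (Polynomial.mem_degreeLT.1 hQ).trans_le ?_
    exact_mod_cast (by omega : k + 1 ≤ 2 * m)
  have hyv : |y| ≤ 3 * k := by omega
  have key := abs_eval_le_of_prod_le hinj.injOn hdeg (K := Real.exp (ε / 2 * k)) (T := T)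
    (t := Real.cos (2 * Real.pi * (φ + (k - 1) / 2 * ω))) (fun j hj => ?_)
    (fun l hl => ?_)
  · rw [hQe]
    refine key.trans ?_
    rw [hcard, ← mul_assoc, show ε * k = ε / 2 * k + ε / 2 * k by ring, Real.exp_add]
    have hT0 : 0 ≤ T := (abs_nonneg _).trans (hT a (by omega) (by omega)).1
    have : ((2 * m : ℕ) : ℝ) ≤ k + 2 := by exact_mod_cast (by omega : 2 * m ≤ k + 2)
    gcongr
    linarith
  · have hj' : |j| ≤ 3 * k := by
      rw [Finset.mem_union, Finset.mem_Ico, Finset.mem_Ico] at hj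
      rcases abs_cases y with h | h <;> rcases abs_cases j with h' | h' <;> omega
    have hmk : m ≤ k := by omega
    have ha1 : |a| ≤ 3 * k := by rcases abs_cases a with h | h <;> omega
    have ha2 : |y + a| ≤ 3 * k := by
      rcases abs_cases y with h | h <;> rcases abs_cases (y + a) with h' | h' <;> omega
    have q1 := hprod m a j hmk ha1 hj' (φ + (k - 1) / 2 * ω)
    have q2 := hprod m (y + a) j hmk ha2 hj' (φ + (k - 1) / 2 * ω)
    have hd' : Disjoint (I₁.erase j) (I₂.erase j) :=
      hdisj.mono (Finset.erase_subset _ _) (Finset.erase_subset _ _)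
    rw [Finset.erase_union_distrib, Finset.prod_union hd', Finset.prod_union hd',
      show ε / 2 * k = ε / 4 * k + ε / 4 * k by ring, Real.exp_add]
    have n1 : ∀ (s : Finset ℤ) (t : ℝ), 0 ≤ ∏ l ∈ s, |t - v l| :=
      fun s t => Finset.prod_nonneg fun _ _ => abs_nonneg _
    rw [mul_mul_mul_comm]
    exact mul_le_mul q1 q2 (n1 _ _) (mul_nonneg (Real.exp_pos _).le (n1 _ _))
  · have hval : ∀ l : ℤ, Q.eval (v l) = amDet lam ω E k (θ + l * ω) := fun l => by
      rw [hQe, show θ + l * ω + ((k : ℝ) - 1) / 2 * ω = θ + (l + ((k : ℝ) - 1) / 2) * ω by ring]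
    rw [hval]
    rw [Finset.mem_union, Finset.mem_Ico, Finset.mem_Ico] at hl
    rcases hl with hl | hl
    · exact (hT l (by omega) (by omega)).1
    · have := (hT (l - y) (by omega) (by omega)).2
      rwa [show y + (l - y) = l by ring] at this

end Nodes

section Localization

variable {lam ω θ c R E : ℝ}

theorem eventually_add_mul_lt_exp (A B : ℝ) {δ : ℝ} (hδ : 0 < δ) :
    ∀ᶠ k : ℕ in atTop, A + B * k < Real.exp (δ * k) := by
  have h0 := (Real.tendsto_exp_div_pow_atTop 1).comp
    ((tendsto_natCast_atTop_atTop (R := ℝ)).const_mul_atTop hδ)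
  filter_upwards [h0.eventually_ge_atTop ((|A| + |B| + 1) / δ), eventually_ge_atTop 1] with k hk hk1
  have hk' : (1 : ℝ) ≤ k := by exact_mod_cast hk1
  simp only [Function.comp, pow_one] at hk
  rw [div_le_div_iff₀ (by positivity) (by positivity)] at hk
  have : δ * ((|A| + |B| + 1) * k) ≤ δ * Real.exp (δ * k) := by linarith
  have := le_of_mul_le_mul_left this hδ
  have := abs_nonneg A
  nlinarith [le_abs_self A, le_abs_self B]

theorem norm_amDet_mul_le {u : ℤ → ℂ} (hu : AMEigenEq lam ω θ u E) (x : ℤ) (p q : ℕ) :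
    |amDet lam ω E (p + q + 1) (θ + x * ω)| * ‖u (x + p)‖ ≤
      |amDet lam ω E q (θ + (x + p + 1 : ℤ) * ω)| * ‖u (x - 1)‖ +
        |amDet lam ω E p (θ + x * ω)| * ‖u (x + p + q + 1)‖ := by
  have h := continuant_smul_solution
    (a := fun j : ℤ => E - lam * Real.cos (2 * Real.pi * (θ + j * ω))) (u := u) (fun n => by
      have := hu n
      rw [Complex.real_smul]
      push_cast at this ⊢
      linear_combination this) x p q
  simp only [continuant_eq_amDet] at h
  have h' := congrArg norm h
  rw [norm_smul, Real.norm_eq_abs] at h'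
  rw [h']
  refine (norm_add_le _ _).trans (le_of_eq ?_)
  rw [norm_smul, norm_smul, Real.norm_eq_abs, Real.norm_eq_abs]

/-- Polynomially bounded solutions of the eigenvalue equation decay exponentially. -/
theorem expDecay_of_norm_le_of_ne_zero (hω : Irrational ω) (hc : 0 < c) (hR : 1 ≤ R)
    (hd : ∀ n : ℤ, n ≠ 0 → c * (1 + |(n : ℝ)|) ^ (-R) ≤ |Real.sin (Real.pi * (n * ω))|)
    (hθ : ∀ n : ℤ, c * (1 + |(n : ℝ)|) ^ (-R) ≤ |Real.sin (Real.pi * (2 * θ + n * ω))|)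
    (hlam : 2 < lam) {u : ℤ → ℂ} (hu : AMEigenEq lam ω θ u E) {C : ℝ}
    (hC : ∀ n, ‖u n‖ ≤ C * (1 + |(n : ℝ)|)) (h0 : u 0 ≠ 0) : ExpDecay u := by
  obtain ⟨L, hL, hup, hlow⟩ := exists_growth_rate lam ω E hlam
  obtain ⟨C₁, hC₁, hup⟩ := hup (L / 16) (by positivity)
  have hC0 : 0 < C := by
    have := (norm_pos_iff.2 h0).trans_le (hC 0)
    simpa using this
  set η := L / 16 with hη
  have hη0 : 0 < η := by positivity
  have hu0 : ∀ᶠ k : ℕ in atTop, Real.exp (-η * k) ≤ ‖u 0‖ := by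
    have : Tendsto (fun k : ℕ => Real.exp (-(η * (k : ℝ)))) atTop (nhds 0) :=
      Real.tendsto_exp_neg_atTop_nhds_zero.comp
        ((tendsto_natCast_atTop_atTop (R := ℝ)).const_mul_atTop hη0)
    filter_upwards [this.eventually_le_const (norm_pos_iff.2 h0)] with k hk
    rwa [neg_mul]
  obtain ⟨N, hN⟩ := eventually_atTop.1 (((eventually_add_mul_lt_exp (32 * C₁ * C) (24 * C₁ * C)
    (δ := L * (5 / 64)) (by positivity)).and hu0).and
    ((abs_amDet_le_of_blocks hω hc hR hd hθ hη0).and (eventually_ge_atTop 4)))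
  have hdecay : ∀ y : ℤ, (N : ℤ) + 2 ≤ |y| → ‖u y‖ ≤ Real.exp (-η * (|(y : ℝ)| - 2)) := by
    intro y hy
    obtain ⟨k, hk1, hk2, φ, hφ⟩ := hlow y.natAbs
    have hyn : |y| = y.natAbs := (Int.natCast_natAbs y).symm
    obtain ⟨⟨hlarge, hu0⟩, hblock, hk4⟩ := hN k (by omega)
    have hkR : (y.natAbs : ℝ) ≤ k + 2 := by exact_mod_cast hk2
    have hkR' : (k : ℝ) ≤ y.natAbs := by exact_mod_cast hk1
    have habs : |(y : ℝ)| = y.natAbs := by rw [Nat.cast_natAbs, Int.cast_abs]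
    by_contra! hcon
    have huy : Real.exp (-η * k) ≤ ‖u y‖ := by
      refine le_trans (Real.exp_le_exp.2 ?_) hcon.le
      rw [habs]
      nlinarith
    set A := C₁ * Real.exp ((L + η) * (3 / 4 * k)) * (C * (4 + 3 * k)) with hA
    have hA0 : 0 < A := by positivity
    have key : ∀ z : ℤ, Real.exp (-η * k) ≤ ‖u z‖ → |z| ≤ k + 2 →
        ∀ l : ℤ, -(k / 4 + k / 2 : ℕ) ≤ l → l ≤ -(k / 4 : ℕ) →
        |amDet lam ω E k (θ + (z + l : ℤ) * ω)| ≤ Real.exp (η * k) * (2 * A) := by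
      intro z hz hzk l hl1 hl2
      obtain ⟨p, hp⟩ : ∃ p : ℕ, l = -p := ⟨(-l).toNat, by omega⟩
      obtain ⟨q, hq⟩ : ∃ q : ℕ, k = p + q + 1 := ⟨k - 1 - p, by omega⟩
      have hp3 : (p : ℝ) ≤ 3 / 4 * k := by
        have : 4 * p ≤ 3 * k := by omega
        have : (4 : ℝ) * p ≤ 3 * k := by exact_mod_cast this
        linarith
      have hq3 : (q : ℝ) ≤ 3 / 4 * k := by
        have : 4 * q ≤ 3 * k := by omega
        have : (4 : ℝ) * q ≤ 3 * k := by exact_mod_cast this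
        linarith
      have hD : ∀ (r : ℕ) (t : ℝ), (r : ℝ) ≤ 3 / 4 * k →
          |amDet lam ω E r t| ≤ C₁ * Real.exp ((L + η) * (3 / 4 * k)) := fun r t hr =>
        (hup r t).trans (by gcongr)
      have hU : ∀ n : ℤ, |n| ≤ 3 * k + 3 → ‖u n‖ ≤ C * (4 + 3 * k) := fun n hn => by
        have h1 : |(n : ℝ)| ≤ 3 * k + 3 := by exact_mod_cast hn
        exact (hC n).trans (mul_le_mul_of_nonneg_left (by linarith) hC0.le)
      have h := norm_amDet_mul_le hu (z + l) p q
      rw [← hq, show z + l + p = z by omega] at h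
      have h' : |amDet lam ω E k (θ + (z + l : ℤ) * ω)| * ‖u z‖ ≤ 2 * A := by
        refine h.trans ?_
        rw [two_mul]
        refine add_le_add (mul_le_mul (hD _ _ hq3) (hU _ ?_) (norm_nonneg _) (by positivity))
          (mul_le_mul (hD _ _ hp3) (hU _ ?_) (norm_nonneg _) (by positivity))
        · rw [abs_le] at *; omega
        · rw [abs_le] at *; omega
      calc _ = Real.exp (η * k) * (|amDet lam ω E k (θ + (z + l : ℤ) * ω)| *
            Real.exp (-η * k)) := by
            rw [mul_left_comm, ← Real.exp_add]
            simp
        _ ≤ Real.exp (η * k) * (2 * A) := by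
            refine mul_le_mul_of_nonneg_left (le_trans ?_ h') (Real.exp_pos _).le
            gcongr
    have hfin := hblock lam E y (Real.exp (η * k) * (2 * A)) (by omega) (by omega)
      (fun l h1 h2 => ⟨by simpa using key 0 hu0 (by simp; omega) l h1 h2,
        key y huy (by omega) l h1 h2⟩) φ
    have hLk : Real.exp (L * k) ≤ Real.exp (L * y.natAbs) := by gcongr
    have h1 : Real.exp (L * k) ≤ 4 * (Real.exp (η * k) * (Real.exp (η * k) * (2 * A))) :=
      hLk.trans (hφ.trans (by gcongr))
    have h2 : 4 * (Real.exp (η * k) * (Real.exp (η * k) * (2 * A))) =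
        (32 * C₁ * C + 24 * C₁ * C * k) * Real.exp (L * (59 / 64) * k) := by
      rw [show L * (59 / 64) * k = η * k + (η * k + (L + η) * (3 / 4 * k)) by rw [hη]; ring,
        Real.exp_add, Real.exp_add, hA]
      ring
    rw [h2, show L * k = L * (5 / 64) * k + L * (59 / 64) * k by ring, Real.exp_add] at h1
    exact absurd (le_of_mul_le_mul_right h1 (Real.exp_pos _)) (not_le.2 hlarge)
  refine ⟨(C * (N + 3) + 1) * Real.exp (η * (N + 2)), by positivity, η, hη0, fun y => ?_⟩
  rw [mul_assoc, ← Real.exp_add]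
  rcases le_or_gt ((N : ℤ) + 2) |y| with h | h
  · refine (hdecay y h).trans ?_
    refine le_trans (Real.exp_le_exp.2 ?_) (le_mul_of_one_le_left (Real.exp_pos _).le ?_)
    · have : (0 : ℝ) ≤ N := Nat.cast_nonneg N
      nlinarith
    · have : 0 ≤ C * (N + 3) := by positivity
      linarith
  · have h1 : |(y : ℝ)| ≤ N + 2 := by exact_mod_cast h.le
    refine (hC y).trans ?_
    have : C * (1 + |(y : ℝ)|) ≤ C * (N + 3) :=
      mul_le_mul_of_nonneg_left (by linarith) hC0.le
    refine (by linarith : _ ≤ C * (N + 3) + 1).trans (le_mul_of_one_le_right (by positivity) ?_)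
    rw [Real.one_le_exp_iff]
    nlinarith

end Localization

section Nonresonance

variable {lam ω θ c R : ℝ}

theorem Diophantine.irrational (h : Diophantine ω) : Irrational ω := by
  obtain ⟨c, hc, r, -, h⟩ := h
  rintro ⟨q, rfl⟩
  have h1 := h q.den (by exact_mod_cast q.den_nz) q.num
  have h2 : ((q.den : ℤ) : ℝ) * (q : ℝ) - (q.num : ℝ) = 0 := by
    rw [sub_eq_zero]
    exact_mod_cast (mul_comm _ _).trans q.mul_den_eq_num
  rw [h2, abs_zero] at h1
  have h3 : 0 < |((q.den : ℤ) : ℝ)| := by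
    rw [abs_pos]
    exact_mod_cast q.den_nz
  exact absurd h1 (not_le.2 (mul_pos hc (Real.rpow_pos_of_pos h3 _)))

theorem Diophantine.exists_le_abs_sin (h : Diophantine ω) : ∃ c : ℝ, 0 < c ∧ ∃ R : ℝ, 1 ≤ R ∧
    ∀ n : ℤ, n ≠ 0 → c * (1 + |(n : ℝ)|) ^ (-R) ≤ |Real.sin (Real.pi * (n * ω))| := by
  obtain ⟨c, hc, r, hr, h⟩ := h
  refine ⟨c, hc, r, hr.le, fun n hn => ?_⟩
  have h1 := h n hn (round (n * ω))
  have hn' : 0 < |(n : ℝ)| := by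
    rw [abs_pos]
    exact_mod_cast hn
  have h2 : (1 + |(n : ℝ)|) ^ (-r) ≤ |(n : ℝ)| ^ (-r) :=
    Real.rpow_le_rpow_of_nonpos hn' (by linarith) (by linarith)
  have h3 := two_mul_abs_sub_round_le (n * ω)
  have h4 := mul_le_mul_of_nonneg_left h2 hc.le
  linarith [abs_nonneg (n * ω - round (n * ω))]

theorem summable_one_div_one_add_sq : Summable fun n : ℤ => 1 / (1 + (n : ℝ) ^ 2) := by
  refine Summable.of_norm_bounded_eventually (Real.summable_one_div_int_pow.2 one_lt_two) ?_
  filter_upwards [eventually_cofinite_ne 0] with n hn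
  have : 0 < (n : ℝ) ^ 2 := by
    have : (n : ℝ) ≠ 0 := by exact_mod_cast hn
    positivity
  rw [Real.norm_of_nonneg (by positivity)]
  exact one_div_le_one_div_of_le this (by linarith)

theorem exists_mul_le_of_eventually {ι : Type*} {f g : ι → ℝ} (hf : ∀ i, 0 < f i)
    (hg : ∀ i, 0 < g i) {c : ℝ} (hc : 0 < c) (h : ∀ᶠ i in cofinite, c * g i ≤ f i) :
    ∃ c' : ℝ, 0 < c' ∧ ∀ i, c' * g i ≤ f i := by
  rw [eventually_cofinite] at h
  set s := h.toFinset with hs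
  obtain ⟨d, hd, hds⟩ : ∃ d : ℝ, 0 < d ∧ ∀ i ∈ s, d * g i ≤ f i := by
    rcases s.eq_empty_or_nonempty with h0 | h0
    · exact ⟨1, one_pos, by simp [h0]⟩
    · obtain ⟨j, _, hj⟩ := s.exists_min_image (fun i => f i / g i) h0
      exact ⟨f j / g j, div_pos (hf j) (hg j), fun i hi => (le_div_iff₀ (hg i)).1 (hj i hi)⟩
  refine ⟨min c d, lt_min hc hd, fun i => ?_⟩
  by_cases hi : i ∈ s
  · exact (mul_le_mul_of_nonneg_right (min_le_right _ _) (hg i).le).trans (hds i hi)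
  · rw [hs, Set.Finite.mem_toFinset, Set.mem_ofPred_eq, not_not] at hi
    exact (mul_le_mul_of_nonneg_right (min_le_left _ _) (hg i).le).trans hi

theorem ae_exists_le_abs_sin (ω : ℝ) : ∀ᵐ θ : ℝ ∂volume, ∃ c : ℝ, 0 < c ∧
    ∀ n : ℤ, c * (1 + |(n : ℝ)|) ^ (-4 : ℝ) ≤ |Real.sin (Real.pi * (2 * θ + n * ω))| := by
  set s : ℤ × ℤ → Set ℝ := fun p =>
    Metric.ball ((p.2 - p.1 * ω) / 2) (1 / (1 + (p.1 : ℝ) ^ 2) * (1 / (1 + (p.2 : ℝ) ^ 2)) / 2)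
    with hs
  have hsum : ∑' p, volume (s p) ≠ ⊤ := by
    have hsm := summable_one_div_one_add_sq.mul_of_nonneg summable_one_div_one_add_sq
      (fun n => by positivity) (fun n => by positivity)
    simp only [hs, Real.volume_ball, mul_div_cancel₀ _ (two_ne_zero' ℝ)]
    exact hsm.tsum_ofReal_ne_top
  have hne : ∀ᵐ θ : ℝ ∂volume, ∀ p : ℤ × ℤ, θ ≠ (p.2 - p.1 * ω) / 2 :=
    ae_all_iff.2 fun p => Measure.ae_ne volume _
  filter_upwards [ae_finite_setOfPred_mem hsum, hne] with θ hfin hne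
  have hdist : ∀ p : ℤ × ℤ, |2 * θ + p.1 * ω - p.2| = 2 * dist θ ((p.2 - p.1 * ω) / 2) := by
    intro p
    rw [Real.dist_eq, ← abs_two (α := ℝ), ← abs_mul, abs_two]
    congr 1
    ring
  have hpos : ∀ n : ℤ, 0 < |Real.sin (Real.pi * (2 * θ + n * ω))| := by
    intro n
    refine lt_of_lt_of_le ?_ (two_mul_abs_sub_round_le _)
    have := hdist (n, round (2 * θ + n * ω))
    simp only at this
    rw [this]
    have := dist_pos.2 (hne (n, round (2 * θ + n * ω)))
    simp only at this
    positivity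
  set K := (2 * |θ| + |ω| + 2) ^ 2 with hK
  have hK0 : 0 < K := by positivity
  refine exists_mul_le_of_eventually hpos
    (fun n => Real.rpow_pos_of_pos (by positivity) _) (c := 1 / K) (by positivity) ?_
  rw [eventually_cofinite]
  refine (hfin.image Prod.fst).subset fun n hn => ?_
  refine ⟨(n, round (2 * θ + n * ω)), ?_, rfl⟩
  rw [Set.mem_ofPred_eq, not_le] at hn
  have h1 := (two_mul_abs_sub_round_le _).trans_lt hn
  have h2 := hdist (n, round (2 * θ + n * ω))
  simp only at h2
  simp only [hs, Set.mem_ofPred_eq, Metric.mem_ball]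
  set m := round (2 * θ + n * ω) with hm
  have hm1 : |(m : ℝ)| ≤ 2 * |θ| + |n| * |ω| + 1 := by
    have a1 := abs_sub_round (2 * θ + n * ω)
    rw [← hm] at a1
    have a2 : |(m : ℝ)| ≤ |2 * θ + n * ω| + |2 * θ + n * ω - m| := by
      have := abs_sub_abs_le_abs_sub (m : ℝ) (2 * θ + n * ω)
      rw [abs_sub_comm] at this
      linarith
    have a3 := abs_add_le (2 * θ) (n * ω)
    rw [abs_mul, abs_mul, abs_two] at a3
    push_cast
    linarith
  set N := |(n : ℝ)| with hN
  have hN0 : 0 ≤ N := abs_nonneg _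
  have hnN : (n : ℝ) ^ 2 = N ^ 2 := (sq_abs _).symm
  have hmK : 1 + (m : ℝ) ^ 2 ≤ K * (1 + N) ^ 2 := by
    rw [← sq_abs (m : ℝ), hK, ← mul_pow]
    have a1 : |(m : ℝ)| + 1 ≤ (2 * |θ| + |ω| + 2) * (1 + N) := by
      push_cast at hm1
      rw [← hN] at hm1
      nlinarith [abs_nonneg θ, abs_nonneg ω, mul_nonneg (abs_nonneg θ) hN0]
    nlinarith [abs_nonneg (m : ℝ)]
  have hprod : (1 + (n : ℝ) ^ 2) * (1 + (m : ℝ) ^ 2) ≤ (1 + N) ^ 2 * (K * (1 + N) ^ 2) := by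
    rw [hnN]
    refine mul_le_mul (by nlinarith) hmK (by positivity) (by positivity)
  have hrp : 1 / K * (1 + N) ^ (-4 : ℝ) = 1 / ((1 + N) ^ 2 * (K * (1 + N) ^ 2)) := by
    rw [Real.rpow_neg (by positivity), show (4 : ℝ) = ((4 : ℕ) : ℝ) by norm_num,
      Real.rpow_natCast]
    field_simp
  have h3 := one_div_le_one_div_of_le (by positivity) hprod
  rw [hrp, h2] at h1
  rw [one_div_mul_one_div]
  have := dist_nonneg (x := θ) (y := ((m : ℝ) - n * ω) / 2)
  linarith

theorem ExpDecay.shift {u : ℤ → ℂ} (h : ExpDecay u) (m : ℤ) : ExpDecay fun n => u (n + m) := by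
  obtain ⟨C, hC, α, hα, h⟩ := h
  refine ⟨C * Real.exp (α * |(m : ℝ)|), by positivity, α, hα, fun n => (h _).trans ?_⟩
  rw [mul_assoc, ← Real.exp_add]
  refine mul_le_mul_of_nonneg_left (Real.exp_le_exp.2 ?_) hC.le
  have := abs_sub_abs_le_abs_sub (n : ℝ) (-m)
  rw [abs_neg, sub_neg_eq_add] at this
  push_cast
  nlinarith

/-- Every nontrivial polynomially bounded solution of the eigenvalue equation decays
exponentially. -/
def IsLocalized (lam ω θ : ℝ) : Prop :=
  ∀ (E : ℝ) (u : ℤ → ℂ) (m : ℤ) (C : ℝ), AMEigenEq lam ω θ u E → u m ≠ 0 →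
    (∀ n, ‖u n‖ ≤ C * (1 + |(n : ℝ)|)) → ExpDecay u

theorem one_add_abs_add_le (x y : ℝ) : 1 + |x + y| ≤ (1 + |y|) * (1 + |x|) := by
  nlinarith [abs_add_le x y, mul_nonneg (abs_nonneg x) (abs_nonneg y)]

theorem ae_isLocalized (hlam : 2 < lam) (hω : Diophantine ω) :
    ∀ᵐ θ : ℝ ∂volume, IsLocalized lam ω θ := by
  obtain ⟨c₁, hc₁, R₁, hR₁, hd⟩ := hω.exists_le_abs_sin
  filter_upwards [ae_exists_le_abs_sin ω] with θ ⟨c₂, hc₂, hθ⟩ E u m C hu hm hC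
  set R := max R₁ 4 with hR
  have hRR : 1 ≤ R := hR₁.trans (le_max_left _ _)
  set b := (1 + |2 * (m : ℝ)|) ^ (-R) with hb
  have hb0 : 0 < b := Real.rpow_pos_of_pos (by positivity) _
  have hb1 : b ≤ 1 := Real.rpow_le_one_of_one_le_of_nonpos (by linarith [abs_nonneg (2 * (m : ℝ))])
    (by linarith)
  set c := min c₁ c₂ * b with hcdef
  have hc : 0 < c := mul_pos (lt_min hc₁ hc₂) hb0
  have hcc₁ : c ≤ c₁ := (mul_le_of_le_one_right (lt_min hc₁ hc₂).le hb1).trans (min_le_left _ _)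
  have hmono : ∀ (n : ℤ) (r : ℝ), r ≤ R → (1 + |(n : ℝ)|) ^ (-R) ≤ (1 + |(n : ℝ)|) ^ (-r) :=
    fun n r hr => Real.rpow_le_rpow_of_exponent_le (by linarith [abs_nonneg (n : ℝ)])
      (by linarith)
  have key := expDecay_of_norm_le_of_ne_zero (lam := lam) (θ := θ + m * ω) (E := E) (c := c)
    (R := R) (u := fun n => u (n + m)) (C := C * (1 + |(m : ℝ)|)) hω.irrational hc hRR
    (fun n hn => (mul_le_mul hcc₁ (hmono n _ (le_max_left _ _))
      (Real.rpow_nonneg (by positivity) _) hc₁.le).trans (hd n hn))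
    (fun n => ?_) hlam (fun n => ?_) (fun n => ?_) (by simpa using hm)
  · simpa using key.shift (-m)
  · have h1 := hθ (n + 2 * m)
    rw [show 2 * (θ + m * ω) + n * ω = 2 * θ + (n + 2 * m : ℤ) * ω by push_cast; ring]
    refine le_trans ?_ h1
    rw [hcdef, mul_assoc]
    refine mul_le_mul (min_le_right _ _) ?_
      (mul_nonneg hb0.le (Real.rpow_nonneg (by positivity) _)) hc₂.le
    refine le_trans ?_ (hmono _ _ (le_max_right _ _))
    rw [hb, ← Real.mul_rpow (by positivity) (by positivity)]
    refine Real.rpow_le_rpow_of_nonpos (by positivity) ?_ (by linarith)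
    push_cast
    exact one_add_abs_add_le _ _
  · have := hu (n + m)
    rw [show θ + ((n + m : ℤ) : ℝ) * ω = θ + m * ω + n * ω by push_cast; ring] at this
    beta_reduce
    rw [show n + 1 + m = n + m + 1 by ring, show n - 1 + m = n + m - 1 by ring]
    exact this
  · have hC0 : 0 ≤ C := by
      have := (norm_nonneg _).trans (hC 0)
      simpa using this
    refine (hC _).trans ?_
    rw [mul_assoc]
    push_cast
    exact mul_le_mul_of_nonneg_left (one_add_abs_add_le _ _) hC0

end Nonresonance

section SpectralMeasure

variable {H : Type*} [NormedAddCommGroup H] [InnerProductSpace ℂ H] [CompleteSpace H]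

open ContinuousLinearMap in
/-- The unitary map from the spectral representation of a bounded self-adjoint operator onto a
cyclic subspace. -/
theorem IsSelfAdjoint.exists_isometry_of_cyclic {a : H →L[ℂ] H} (ha : IsSelfAdjoint a) (v : H) :
    ∃ (μ : Measure (spectrum ℂ a)) (_ : IsFiniteMeasure μ) (U : Lp ℂ 2 μ →L[ℂ] H),
      (∀ f, ‖U f‖ = ‖f‖) ∧ ∀ g : C(spectrum ℂ a, ℂ),
        U (ContinuousMap.toLp 2 μ ℂ g) = cfcHom (R := ℂ) ha.isStarNormal g v := by
  set Φ := cfcHom (R := ℂ) ha.isStarNormal with hΦ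
  have hnorm : ∀ g : C(spectrum ℂ a, ℂ), inner ℂ v (Φ (star g * g) v) = (‖Φ g v‖ : ℂ) ^ 2 := by
    intro g
    rw [map_mul, map_star, star_eq_adjoint, mul_apply_eq_comp, adjoint_inner_right,
      inner_self_eq_norm_sq_to_K]
    rfl
  let coe : CompactlySupportedContinuousMap (spectrum ℂ a) ℝ → C(spectrum ℂ a, ℂ) :=
    fun f => ⟨fun z => (f z : ℂ), by fun_prop⟩
  let Λ₀ : CompactlySupportedContinuousMap (spectrum ℂ a) ℝ →ₗ[ℝ] ℝ :=
    { toFun := fun f => (inner ℂ v (Φ (coe f) v)).re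
      map_add' := fun f g => by
        have : coe (f + g) = coe f + coe g := by ext z; simp [coe]
        rw [this, map_add, add_apply, inner_add_right, Complex.add_re]
      map_smul' := fun r f => by
        have : coe (r • f) = (r : ℂ) • coe f := by ext z; simp [coe]
        rw [this, map_smul, smul_apply, inner_smul_right, Complex.re_ofReal_mul]
        rfl }
  let Λ : CompactlySupportedContinuousMap (spectrum ℂ a) ℝ →ₚ[ℝ] ℝ :=
    PositiveLinearMap.mk₀ Λ₀ fun f hf => by
      let g : C(spectrum ℂ a, ℂ) := ⟨fun z => (Real.sqrt (f z) : ℂ), by fun_prop⟩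
      have : coe f = star g * g := by
        ext z
        simp only [coe, g, ContinuousMap.mul_apply, ContinuousMap.star_apply, ContinuousMap.coe_mk,
          RCLike.star_def, Complex.conj_ofReal]
        rw [← Complex.ofReal_mul, Real.mul_self_sqrt (hf z)]
      change 0 ≤ (inner ℂ v (Φ (coe f) v)).re
      rw [this, hnorm, ← Complex.ofReal_pow, Complex.ofReal_re]
      positivity
  set μ := RealRMK.rieszMeasure Λ with hμ
  have hiso : ∀ g : C(spectrum ℂ a, ℂ), ‖Φ g v‖ = ‖ContinuousMap.toLp 2 μ ℂ g‖ := by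
    intro g
    let f : CompactlySupportedContinuousMap (spectrum ℂ a) ℝ :=
      ⟨⟨fun z => ‖g z‖ ^ 2, by fun_prop⟩, HasCompactSupport.of_compactSpace _⟩
    have hf : coe f = star g * g := by
      ext z
      change ((‖g z‖ ^ 2 : ℝ) : ℂ) = star (g z) * g z
      rw [RCLike.star_def, Complex.conj_mul']
      push_cast
      rfl
    have h1 : ∫ z, f z ∂μ = ‖Φ g v‖ ^ 2 := by
      rw [hμ, RealRMK.integral_rieszMeasure]
      change (inner ℂ v (Φ (coe f) v)).re = _
      rw [hf, hnorm, ← Complex.ofReal_pow, Complex.ofReal_re]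
    have h2 := ContinuousMap.inner_toLp (𝕜 := ℂ) μ g g
    rw [inner_self_eq_norm_sq_to_K] at h2
    have h3 : ∀ z, g z * (starRingEnd ℂ) (g z) = ((f z : ℝ) : ℂ) := fun z => by
      rw [Complex.mul_conj']
      change _ = ((‖g z‖ ^ 2 : ℝ) : ℂ)
      push_cast
      rfl
    simp only [h3] at h2
    rw [integral_complex_ofReal, h1] at h2
    have h4 : ‖ContinuousMap.toLp 2 μ ℂ g‖ ^ 2 = ‖Φ g v‖ ^ 2 := by
      apply Complex.ofReal_injective
      rw [Complex.ofReal_pow]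
      exact h2
    exact (pow_left_inj₀ (norm_nonneg _) (norm_nonneg _) two_ne_zero).1 h4.symm
  have hdense : DenseRange (ContinuousMap.toLp 2 μ ℂ : C(spectrum ℂ a, ℂ) →L[ℂ] Lp ℂ 2 μ) :=
    ContinuousMap.toLp_denseRange ℂ μ ℂ (by norm_num)
  let Φv : C(spectrum ℂ a, ℂ) →ₗ[ℂ] H :=
    { toFun := fun g => Φ g v
      map_add' := fun f g => by rw [map_add, add_apply]
      map_smul' := fun r f => by rw [map_smul, smul_apply, RingHom.id_apply] }
  let e : C(spectrum ℂ a, ℂ) →ₗ[ℂ] Lp ℂ 2 μ :=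
    (ContinuousMap.toLp 2 μ ℂ : C(spectrum ℂ a, ℂ) →L[ℂ] Lp ℂ 2 μ).toLinearMap
  let U : Lp ℂ 2 μ →L[ℂ] H := Φv.extendOfNorm e
  have hU : ∀ g : C(spectrum ℂ a, ℂ), U (ContinuousMap.toLp 2 μ ℂ g) = Φ g v := fun g =>
    LinearMap.extendOfNorm_eq (f := Φv) (e := e) hdense
      ⟨1, fun g => by rw [one_mul]; exact (hiso g).le⟩ g
  have hUiso : ∀ f, ‖U f‖ = ‖f‖ := fun f => by
    refine hdense.induction_on (p := fun f => ‖U f‖ = ‖f‖) f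
      (isClosed_eq (by fun_prop) (by fun_prop)) fun g => ?_
    rw [hU, hiso]
  exact ⟨μ, inferInstance, U, hUiso, hU⟩

open ContinuousLinearMap in
theorem IsSelfAdjoint.adjoint_apply_ae_eq_mul {a : H →L[ℂ] H} (ha : IsSelfAdjoint a) {v : H}
    {μ : Measure (spectrum ℂ a)} [IsFiniteMeasure μ] {U : Lp ℂ 2 μ →L[ℂ] H}
    (hU : ∀ g : C(spectrum ℂ a, ℂ),
      U (ContinuousMap.toLp 2 μ ℂ g) = cfcHom (R := ℂ) ha.isStarNormal g v) (x : H) :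
    adjoint U (a x) =ᵐ[μ] fun z => (z : ℂ) * adjoint U x z := by
  have hdense : DenseRange (ContinuousMap.toLp 2 μ ℂ : C(spectrum ℂ a, ℂ) →L[ℂ] Lp ℂ 2 μ) :=
    ContinuousMap.toLp_denseRange ℂ μ ℂ (by norm_num)
  obtain ⟨F, hF⟩ : ∃ F, F = adjoint U x := ⟨_, rfl⟩
  rw [← hF]
  have hbd : ∀ z : spectrum ℂ a, ‖(z : ℂ)‖ ≤ ‖a‖ * ‖(1 : H →L[ℂ] H)‖ := fun z =>
    spectrum.norm_le_norm_mul_of_mem z.2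
  have hmem : MemLp (fun z : spectrum ℂ a => (z : ℂ) * F z) 2 μ := by
    refine (Lp.memLp F).of_le_mul (c := ‖a‖ * ‖(1 : H →L[ℂ] H)‖)
      ((continuous_subtype_val.aestronglyMeasurable).mul (Lp.aestronglyMeasurable F)) ?_
    filter_upwards with z
    rw [norm_mul]
    exact mul_le_mul_of_nonneg_right (hbd z) (norm_nonneg _)
  have heq : adjoint U (a x) = hmem.toLp := by
    refine ext_inner_left ℂ fun f => ?_
    refine hdense.induction_on
      (p := fun f => inner ℂ f (adjoint U (a x)) = inner ℂ f hmem.toLp) f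
      (isClosed_eq (by fun_prop) (by fun_prop)) fun g => ?_
    let ι : C(spectrum ℂ a, ℂ) := (ContinuousMap.id ℂ).restrict (spectrum ℂ a)
    have h1 : inner ℂ (ContinuousMap.toLp 2 μ ℂ g) (adjoint U (a x)) =
        inner ℂ (ContinuousMap.toLp 2 μ ℂ (ι * g)) F := by
      have hιa : cfcHom (R := ℂ) ha.isStarNormal ι = a := cfcHom_id _
      rw [adjoint_inner_right, hF, adjoint_inner_right, hU, hU, map_mul, hιa, mul_apply_eq_comp]
      exact (ha.isSymmetric _ _).symm
    rw [h1, L2.inner_def, L2.inner_def]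
    refine integral_congr_ae ?_
    filter_upwards [ContinuousMap.coeFn_toLp (p := 2) (𝕜 := ℂ) μ g,
      ContinuousMap.coeFn_toLp (p := 2) (𝕜 := ℂ) μ (ι * g), hmem.coeFn_toLp] with z e1 e2 e3
    rw [e1, e2, e3, ContinuousMap.mul_apply]
    have hz : (starRingEnd ℂ) (z : ℂ) = z := by
      rw [ha.mem_spectrum_eq_re z.2, Complex.conj_ofReal]
    simp only [RCLike.inner_apply, map_mul]
    change _ * ((starRingEnd ℂ) (z : ℂ) * _) = _
    rw [hz]
    ring
  rw [heq]
  exact hmem.coeFn_toLp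

open ContinuousLinearMap in
/-- The spectral representation of a bounded self-adjoint operator on a cyclic subspace, expressed
through the adjoint of the unitary map onto this subspace. -/
theorem IsSelfAdjoint.exists_spectralMeasure {a : H →L[ℂ] H} (ha : IsSelfAdjoint a) (v : H) :
    ∃ (μ : Measure (spectrum ℂ a)) (_ : IsFiniteMeasure μ) (T : H →L[ℂ] Lp ℂ 2 μ),
      (∀ x, ‖T x‖ ≤ ‖x‖) ∧ (T v =ᵐ[μ] fun _ => 1) ∧ adjoint T (T v) = v ∧
        ∀ x, T (a x) =ᵐ[μ] fun z => (z : ℂ) * T x z := by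
  obtain ⟨μ, hfin, U, hUiso, hU⟩ := ha.exists_isometry_of_cyclic v
  have hUU : ∀ f, adjoint U (U f) = f := fun f => by
    have := (norm_map_iff_adjoint_comp_self U).1 hUiso
    exact congrArg (fun S : Lp ℂ 2 μ →L[ℂ] Lp ℂ 2 μ => S f) this
  have hU1 : U (ContinuousMap.toLp 2 μ ℂ 1) = v := by rw [hU, map_one, one_apply_eq_self]
  have hTv : adjoint U v = ContinuousMap.toLp 2 μ ℂ 1 := by
    rw [← hUU (ContinuousMap.toLp 2 μ ℂ 1), hU1]
  refine ⟨μ, hfin, adjoint U, fun x => ?_, ?_, ?_, ha.adjoint_apply_ae_eq_mul hU⟩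
  · refine (le_opNorm _ _).trans (mul_le_of_le_one_left (norm_nonneg _) ?_)
    rw [LinearIsometryEquiv.norm_map]
    exact opNorm_le_bound _ zero_le_one fun f => by rw [hUiso, one_mul]
  · rw [hTv]
    exact ContinuousMap.coeFn_toLp (p := 2) (𝕜 := ℂ) μ (1 : C(spectrum ℂ a, ℂ))
  · rw [adjoint_adjoint, hTv, hU1]

end SpectralMeasure

section Jacobi

variable {V : ℤ → ℝ} {C : ℝ}

theorem memℓp_comp_equiv {ι : Type*} {f : ι → ℂ} (hf : Memℓp f 2) (e : ι ≃ ι) :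
    Memℓp (fun n => f (e n)) 2 := by
  rw [memℓp_gen_iff (by norm_num)] at hf ⊢
  exact hf.comp_injective e.injective

/-- Reindexing a square summable sequence. -/
def l2Comp (e : ℤ ≃ ℤ) (f : l2Z) : l2Z := ⟨fun n => f (e n), memℓp_comp_equiv (lp.memℓp f) e⟩

theorem l2Comp_apply (e : ℤ ≃ ℤ) (f : l2Z) (n : ℤ) : l2Comp e f n = f (e n) := rfl

theorem inner_l2Comp_left (e : ℤ ≃ ℤ) (f g : l2Z) :
    inner ℂ (l2Comp e f) g = inner ℂ f (l2Comp e.symm g) := by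
  rw [lp.inner_eq_tsum, lp.inner_eq_tsum, ← e.tsum_eq fun n => inner ℂ (f n) _]
  simp only [l2Comp_apply, Equiv.symm_apply_apply]

theorem memℓp_ofReal_mul (hV : ∀ n, |V n| ≤ C) {f : ℤ → ℂ} (hf : Memℓp f 2) :
    Memℓp (fun n => (V n : ℂ) * f n) 2 := by
  have h := hf.const_mul (C : ℂ)
  rw [memℓp_gen_iff (by norm_num)] at h ⊢
  refine h.of_nonneg_of_le (fun n => by positivity) fun n => ?_
  refine Real.rpow_le_rpow (norm_nonneg _) ?_ (by norm_num)
  rw [norm_mul, norm_mul, Complex.norm_real, Complex.norm_real]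
  exact mul_le_mul_of_nonneg_right ((hV n).trans (le_abs_self C)) (norm_nonneg _)

/-- Multiplication of square summable sequences by a bounded potential. -/
def l2Mul (hV : ∀ n, |V n| ≤ C) (f : l2Z) : l2Z :=
  ⟨_, memℓp_ofReal_mul hV (lp.memℓp f)⟩

theorem l2Mul_apply (hV : ∀ n, |V n| ≤ C) (f : l2Z) (n : ℤ) :
    l2Mul hV f n = (V n : ℂ) * f n := rfl

theorem inner_l2Mul_left (hV : ∀ n, |V n| ≤ C) (f g : l2Z) :
    inner ℂ (l2Mul hV f) g = inner ℂ f (l2Mul hV g) := by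
  rw [lp.inner_eq_tsum, lp.inner_eq_tsum]
  refine tsum_congr fun n => ?_
  simp only [l2Mul_apply, RCLike.inner_apply, map_mul, Complex.conj_ofReal]
  ring

/-- The Jacobi operator with bounded potential `V`, as a linear map. -/
def jacobiLinearMap (hV : ∀ n, |V n| ≤ C) : l2Z →ₗ[ℂ] l2Z where
  toFun f := l2Comp (Equiv.addRight 1) f + l2Comp (Equiv.addRight 1).symm f +
    l2Mul hV f
  map_add' f g := by
    ext n
    simp only [lp.coeFn_add, Pi.add_apply, l2Comp_apply, l2Mul_apply]
    ring
  map_smul' c f := by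
    ext n
    simp only [lp.coeFn_add, lp.coeFn_smul, Pi.add_apply, Pi.smul_apply, RingHom.id_apply,
      smul_eq_mul, l2Comp_apply, l2Mul_apply]
    ring

theorem jacobiLinearMap_isSymmetric (hV : ∀ n, |V n| ≤ C) :
    (jacobiLinearMap hV).IsSymmetric := by
  intro f g
  change inner ℂ (_ + _ + _) g = inner ℂ f (_ + _ + _)
  simp only [inner_add_left, inner_add_right, inner_l2Comp_left, Equiv.symm_symm,
    inner_l2Mul_left hV]
  ring

theorem exists_isSelfAdjoint_jacobi (hV : ∀ n, |V n| ≤ C) :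
    ∃ a : l2Z →L[ℂ] l2Z, IsSelfAdjoint a ∧
      ∀ f n, a f n = f (n + 1) + f (n - 1) + (V n : ℂ) * f n :=
  ⟨(jacobiLinearMap_isSymmetric hV).toSelfAdjoint,
    (jacobiLinearMap_isSymmetric hV).toSelfAdjoint.2, fun f n =>
      congrArg (fun g : l2Z => g n)
        ((jacobiLinearMap_isSymmetric hV).toSelfAdjoint_apply (x := f))⟩

theorem Orthonormal.countable_of_l2Z {ι : Type*} {v : ι → l2Z} (hv : Orthonormal ℂ v) :
    Countable ι := by
  have h : ∀ n : ℤ, {i | v i n ≠ 0}.Countable := fun n => by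
    have := (hv.inner_products_summable (lp.single 2 n (1 : ℂ))).countable_support
    refine this.mono fun i hi => ?_
    rw [Function.mem_support, lp.inner_single_right]
    simpa using hi
  have h2 : (Set.univ : Set ι) ⊆ ⋃ n, {i | v i n ≠ 0} := fun i _ => by
    by_contra! hcon
    refine hv.ne_zero i ?_
    ext n
    simpa using fun h => hcon (Set.mem_iUnion.2 ⟨n, h⟩)
  exact Set.countable_univ_iff.1 ((Set.countable_iUnion h).mono h2)

theorem l2Z_eq_zero_of_inner_single {w : l2Z}
    (h : ∀ n : ℤ, inner ℂ (lp.single 2 n (1 : ℂ) : l2Z) w = 0) : w = 0 := by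
  ext n
  have := h n
  rw [lp.inner_single_left] at this
  simpa using this

end Jacobi

section PurePoint

variable {H : Type*} [NormedAddCommGroup H] [InnerProductSpace ℂ H] [CompleteSpace H]

open ContinuousLinearMap in
/-- If the spectral measure of `v` is carried by a countable set of points, then `v` is orthogonal
to every vector which is orthogonal to the eigenvectors. -/
theorem ContinuousLinearMap.inner_eq_zero_of_forall_eigenvector {a : H →L[ℂ] H}
    (ha : a.toLinearMap.IsSymmetric) {v w : H} {S : Set ℝ} (hS : S.Countable) {X : Type*}
    [MeasurableSpace X] [MeasurableSingletonClass X] {μ : Measure X} [IsFiniteMeasure μ]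
    {φ : X → ℝ} (hφ : Function.Injective φ) {T : H →L[ℂ] Lp ℂ 2 μ} (hT : adjoint T (T v) = v)
    (hmul : ∀ x, T (a x) =ᵐ[μ] fun z => (φ z : ℂ) * T x z) (hμ : ∀ᵐ z ∂μ, φ z ∈ S)
    (hw : ∀ E ∈ S, ∀ x, a x = (E : ℂ) • x → inner ℂ x w = 0) : inner ℂ v w = 0 := by
  have hpt : ∀ E : X, φ E ∈ S → μ {E} = 0 ∨ T w E = 0 := by
    intro E hE
    obtain ⟨f, hf⟩ : ∃ f, f = indicatorConstLp 2 (measurableSet_singleton E)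
      (measure_ne_top μ {E}) (1 : ℂ) := ⟨_, rfl⟩
    have hin : ∀ g : Lp ℂ 2 μ, inner ℂ f g = μ.real {E} * g E := fun g => by
      rw [hf, L2.inner_indicatorConstLp_one, integral_singleton, Complex.real_smul]
    have hTa : ∀ x, μ.real {E} * T (a x) E = μ.real {E} * (φ E * T x E) := fun x => by
      have := setIntegral_congr_ae (g := fun z => (φ z : ℂ) * T x z) (measurableSet_singleton E)
        ((hmul x).mono fun z hz _ => hz)
      rw [integral_singleton, integral_singleton, Complex.real_smul, Complex.real_smul] at this
      exact this
    have heig : a (adjoint T f) = (φ E : ℂ) • adjoint T f := by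
      refine ext_inner_right ℂ fun x => ?_
      rw [inner_smul_left, Complex.conj_ofReal, adjoint_inner_left, hin]
      rw [show inner ℂ (a (adjoint T f)) x = inner ℂ (adjoint T f) (a x) from ha _ _,
        adjoint_inner_left, hin, hTa]
      ring
    have := hw _ hE _ heig
    rw [adjoint_inner_left, hin, mul_eq_zero, Complex.ofReal_eq_zero,
      measureReal_eq_zero_iff] at this
    exact this
  have hTw : T w =ᵐ[μ] 0 := by
    have hc : {z : X | φ z ∈ S ∧ μ {z} = 0}.Countable :=
      (hS.preimage hφ).mono fun z hz => hz.1
    have h0 : μ {z : X | φ z ∈ S ∧ μ {z} = 0} = 0 := by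
      rw [← Set.biUnion_of_singleton {z : X | φ z ∈ S ∧ μ {z} = 0}]
      exact (measure_biUnion_null_iff hc).2 fun z hz => hz.2
    filter_upwards [hμ, measure_eq_zero_iff_ae_notMem.1 h0] with z hz hz'
    exact (hpt z hz).resolve_left fun h => hz' ⟨hz, h⟩
  rw [← hT, adjoint_inner_left, (Lp.eq_zero_iff_ae_eq_zero).2 hTw, inner_zero_right]

end PurePoint

section GeneralizedEigenfunctions

theorem ExpDecay.memℓp {u : ℤ → ℂ} (hu : ExpDecay u) : Memℓp u 2 := by
  obtain ⟨C, hC, α, hα, h⟩ := hu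
  rw [memℓp_gen_iff (by norm_num)]
  have hm : 0 < min 1 α := lt_min one_pos hα
  refine (summable_one_div_one_add_sq.mul_left ((C / min 1 α) ^ 2)).of_nonneg_of_le
    (fun n => by positivity) fun n => ?_
  have h1 : min 1 α * (1 + |(n : ℝ)|) ≤ Real.exp (α * |(n : ℝ)|) := by
    have := Real.add_one_le_exp (α * |(n : ℝ)|)
    have h2 := mul_le_mul_of_nonneg_right (min_le_right 1 α) (abs_nonneg (n : ℝ))
    linarith [min_le_left 1 α]
  have h2 : ‖u n‖ ≤ C / min 1 α / (1 + |(n : ℝ)|) := by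
    refine (h n).trans ?_
    rw [neg_mul, Real.exp_neg, ← div_eq_mul_inv, div_div]
    exact div_le_div_of_nonneg_left hC.le (by positivity) h1
  rw [ENNReal.toReal_ofNat, Real.rpow_two]
  refine (pow_le_pow_left₀ (norm_nonneg _) h2 2).trans ?_
  rw [div_pow (C / min 1 α), div_eq_mul_one_div]
  refine mul_le_mul_of_nonneg_left (one_div_le_one_div_of_le (by positivity) ?_) (by positivity)
  nlinarith [abs_nonneg (n : ℝ), sq_abs (n : ℝ)]

theorem ae_exists_norm_le_mul_one_add_abs {X : Type*} [MeasurableSpace X] {μ : Measure X}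
    {F : ℤ → Lp ℂ 2 μ} (hF : ∀ n, ‖F n‖ ≤ 1) :
    ∀ᵐ z ∂μ, ∃ C : ℝ, ∀ n : ℤ, ‖F n z‖ ≤ C * (1 + |(n : ℝ)|) := by
  set G : ℤ → X → ENNReal := fun n z => ENNReal.ofReal (1 / (1 + (n : ℝ) ^ 2)) * ‖F n z‖ₑ ^ 2
    with hG
  have hae : ∀ n, AEMeasurable (fun z => ‖F n z‖ₑ ^ 2) μ := fun n =>
    ((Lp.aestronglyMeasurable (F n)).enorm).pow_const 2
  have hGae : ∀ n, AEMeasurable (G n) μ := fun n => (hae n).const_mul _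
  have hint : ∀ n, ∫⁻ z, ‖F n z‖ₑ ^ 2 ∂μ ≤ 1 := fun n => by
    have h1 := eLpNorm_nnreal_pow_eq_lintegral (μ := μ) (f := F n) (p := 2) two_ne_zero
    simp only [NNReal.coe_ofNat, ENNReal.rpow_ofNat, ENNReal.coe_ofNat] at h1
    rw [← h1, ← Lp.enorm_def]
    refine pow_le_one' ?_ 2
    rw [← ofReal_norm, ENNReal.ofReal_le_one]
    exact hF n
  have htop : ∫⁻ z, ∑' n, G n z ∂μ ≠ ⊤ := by
    rw [lintegral_tsum hGae]
    refine ne_top_of_le_ne_top summable_one_div_one_add_sq.tsum_ofReal_ne_top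
      (ENNReal.tsum_le_tsum fun n => ?_)
    rw [hG, lintegral_const_mul'' _ (hae n)]
    exact mul_le_of_le_one_right' (hint n)
  filter_upwards [ae_lt_top' (AEMeasurable.tsum hGae) htop] with z hz
  set S := (∑' n, G n z).toReal with hS
  refine ⟨Real.sqrt S, fun n => ?_⟩
  have h1 : (G n z).toReal ≤ S := ENNReal.toReal_mono hz.ne (ENNReal.le_tsum n)
  have h2 : (G n z).toReal = 1 / (1 + (n : ℝ) ^ 2) * ‖F n z‖ ^ 2 := by
    rw [hG]
    simp only [ENNReal.toReal_mul, ENNReal.toReal_pow, toReal_enorm]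
    rw [ENNReal.toReal_ofReal (by positivity)]
  rw [h2, one_div_mul_eq_div, div_le_iff₀ (by positivity)] at h1
  have hS0 : 0 ≤ S := ENNReal.toReal_nonneg
  refine abs_le_of_sq_le_sq' (a := ‖F n z‖) ?_ (by positivity) |>.2
  rw [mul_pow, Real.sq_sqrt hS0]
  refine h1.trans (mul_le_mul_of_nonneg_left ?_ hS0)
  nlinarith [abs_nonneg (n : ℝ), sq_abs (n : ℝ)]

end GeneralizedEigenfunctions

section EigenvectorBasis

variable {H : Type} [NormedAddCommGroup H] [InnerProductSpace ℂ H] [CompleteSpace H]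

open ContinuousLinearMap in
/-- A bounded self-adjoint operator whose eigenvectors are total has an orthonormal basis of
eigenvectors. -/
theorem ContinuousLinearMap.exists_hilbertBasis_of_eigenvectors {a : H →L[ℂ] H}
    (ha : a.toLinearMap.IsSymmetric)
    (htot : ∀ w, (∀ (E : ℝ) x, a x = (E : ℂ) • x → inner ℂ x w = 0) → w = 0) :
    ∃ (ι : Type) (v : HilbertBasis ι ℂ H), ∀ i, ∃ E : ℝ, a (v i) = (E : ℂ) • v i := by
  let K : ℝ → Submodule ℂ H := fun E => Module.End.eigenspace a.toLinearMap (E : ℂ)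
  have hK : ∀ E x, x ∈ K E ↔ a x = (E : ℂ) • x := fun E x => Module.End.mem_eigenspace_iff
  have hcl : ∀ E, IsClosed (K E : Set H) := fun E => by
    have : (K E : Set H) = {x | a x = (E : ℂ) • x} := Set.ext (hK E)
    rw [this]
    exact isClosed_eq (by fun_prop) (by fun_prop)
  have : ∀ E, CompleteSpace (K E) := fun E => (hcl E).completeSpace_coe
  choose s b hb using fun E => exists_hilbertBasis ℂ (K E)
  have hort : Orthonormal ℂ fun i : (E : ℝ) × s E => (b i.1 i.2 : H) :=
    (ha.orthogonalFamily_eigenspaces.comp Complex.ofReal_injective).orthonormal_sigma_orthonormal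
      fun E => (b E).orthonormal
  refine ⟨_, HilbertBasis.mkOfOrthogonalEqBot hort ?_, fun i => ⟨i.1, ?_⟩⟩
  · rw [Submodule.eq_bot_iff]
    refine fun w hw => htot w fun E x hx => ?_
    set p := adjoint (K E).subtypeL w with hp
    have hp0 : p = 0 := by
      refine (b E).repr.map_eq_zero_iff.1 ?_
      ext i
      rw [HilbertBasis.repr_apply_apply, hp, adjoint_inner_right]
      exact (Submodule.mem_orthogonal _ _).1 hw _ (Submodule.subset_span ⟨⟨E, i⟩, rfl⟩)
    have h := adjoint_inner_right (K E).subtypeL ⟨x, (hK E x).2 hx⟩ w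
    rw [← hp, hp0, inner_zero_right] at h
    exact h.symm
  · rw [HilbertBasis.coe_mkOfOrthogonalEqBot]
    exact (hK _ _).1 (b i.1 i.2).2

end EigenvectorBasis

section AlmostMathieu

variable {lam ω θ : ℝ} {a : l2Z →L[ℂ] l2Z}

theorem apply_eq_smul_iff_aMEigenEq
    (happ : ∀ f n, a f n = f (n + 1) + f (n - 1)
      + ((lam * Real.cos (2 * Real.pi * (θ + (n : ℝ) * ω)) : ℝ) : ℂ) * f n) (f : l2Z) (E : ℝ) :
    a f = (E : ℂ) • f ↔ AMEigenEq lam ω θ f E := by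
  constructor
  · intro h n
    rw [← happ, h]
    rfl
  · intro h
    ext n
    rw [happ, h n]
    rfl

theorem LinearMap.IsSymmetric.countable_eigenvalues_l2Z (ha : a.toLinearMap.IsSymmetric) :
    {E : ℝ | ∃ x : l2Z, x ≠ 0 ∧ a x = (E : ℂ) • x}.Countable := by
  set S := {E : ℝ | ∃ x : l2Z, x ≠ 0 ∧ a x = (E : ℂ) • x}
  choose x hx0 hx using fun E : S => E.2
  have hort : Orthonormal ℂ fun E : S => ((‖x E‖⁻¹ : ℝ) : ℂ) • x E := by
    refine ⟨fun E => ?_, fun E E' hE => ?_⟩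
    · rw [norm_smul, Complex.norm_real, norm_inv, norm_norm,
        inv_mul_cancel₀ (norm_ne_zero_iff.2 (hx0 E))]
    · have h := ha.orthogonalFamily_eigenspaces.comp Complex.ofReal_injective
        (fun h => hE (Subtype.ext h)) ⟨x E, Module.End.mem_eigenspace_iff.2 (hx E)⟩
        ⟨x E', Module.End.mem_eigenspace_iff.2 (hx E')⟩
      change inner ℂ (x E) (x E') = 0 at h
      beta_reduce
      rw [inner_smul_left, inner_smul_right, h, mul_zero, mul_zero]
  exact hort.countable_of_l2Z

theorem apply_single_eq
    (happ : ∀ f n, a f n = f (n + 1) + f (n - 1)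
      + ((lam * Real.cos (2 * Real.pi * (θ + (n : ℝ) * ω)) : ℝ) : ℂ) * f n) (n : ℤ) :
    a (lp.single 2 n (1 : ℂ)) = lp.single 2 (n + 1) (1 : ℂ) + lp.single 2 (n - 1) (1 : ℂ)
      + ((lam * Real.cos (2 * Real.pi * (θ + (n : ℝ) * ω)) : ℝ) : ℂ) • lp.single 2 n (1 : ℂ) := by
  ext k
  rw [happ]
  simp only [lp.coeFn_add, lp.coeFn_smul, Pi.add_apply, Pi.smul_apply, lp.single_apply,
    Pi.single_apply, smul_eq_mul, eq_sub_iff_add_eq, sub_eq_iff_eq_add]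
  rw [add_comm (if k + 1 = n then (1 : ℂ) else 0)]
  congr 1
  by_cases h : k = n
  · rw [h]
  · rw [if_neg h, mul_zero, mul_zero]

/-- The spectral measures are carried by the eigenvalues. -/
theorem IsLocalized.ae_mem_eigenvalues (hloc : IsLocalized lam ω θ)
    (happ : ∀ f n, a f n = f (n + 1) + f (n - 1)
      + ((lam * Real.cos (2 * Real.pi * (θ + (n : ℝ) * ω)) : ℝ) : ℂ) * f n) {X : Type*}
    [MeasurableSpace X] {μ : Measure X} {φ : X → ℝ} {T : l2Z →L[ℂ] Lp ℂ 2 μ}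
    (hTn : ∀ x, ‖T x‖ ≤ ‖x‖) {m : ℤ} (hTm : T (lp.single 2 m (1 : ℂ)) =ᵐ[μ] fun _ => 1)
    (hmul : ∀ x, T (a x) =ᵐ[μ] fun z => (φ z : ℂ) * T x z) :
    ∀ᵐ z ∂μ, φ z ∈ {E : ℝ | ∃ x : l2Z, x ≠ 0 ∧ a x = (E : ℂ) • x} := by
  obtain ⟨F, hF⟩ : ∃ F : ℤ → Lp ℂ 2 μ, F = fun n => T (lp.single 2 n (1 : ℂ)) := ⟨_, rfl⟩
  have hFn : ∀ n, T (lp.single 2 n (1 : ℂ)) = F n := fun n => by rw [hF]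
  have hF1 : ∀ n, ‖F n‖ ≤ 1 := fun n => by
    rw [← hFn]
    refine (hTn _).trans_eq ?_
    rw [lp.norm_single (by norm_num), norm_one]
  have hrec : ∀ n, ∀ᵐ z ∂μ, (φ z : ℂ) * F n z = F (n + 1) z + F (n - 1) z
      + ((lam * Real.cos (2 * Real.pi * (θ + (n : ℝ) * ω)) : ℝ) : ℂ) * F n z := fun n => by
    have h := hmul (lp.single 2 n (1 : ℂ))
    rw [apply_single_eq happ, map_add, map_add, map_smul, hFn, hFn, hFn] at h
    filter_upwards [h, Lp.coeFn_add (F (n + 1) + F (n - 1))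
      (((lam * Real.cos (2 * Real.pi * (θ + (n : ℝ) * ω)) : ℝ) : ℂ) • F n),
      Lp.coeFn_add (F (n + 1)) (F (n - 1)),
      Lp.coeFn_smul ((lam * Real.cos (2 * Real.pi * (θ + (n : ℝ) * ω)) : ℝ) : ℂ) (F n)]
      with z h1 h2 h3 h4
    rw [← h1, h2, Pi.add_apply, h3, Pi.add_apply, h4, Pi.smul_apply, smul_eq_mul]
  rw [hFn] at hTm
  filter_upwards [hTm, ae_all_iff.2 hrec, ae_exists_norm_le_mul_one_add_abs hF1]
    with z h1 h2 ⟨C, hC⟩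
  have hu : AMEigenEq lam ω θ (fun n => F n z) (φ z) := fun n => (h2 n).symm
  have hm : F m z ≠ 0 := by
    rw [h1]
    exact one_ne_zero
  have hmem := (hloc _ _ m C hu hm hC).memℓp
  refine ⟨⟨_, hmem⟩, fun h0 => hm ?_, (apply_eq_smul_iff_aMEigenEq happ _ _).2 hu⟩
  exact congrArg (fun g : l2Z => g m) h0

theorem IsLocalized.eq_zero_of_forall_inner_eigenvector (hloc : IsLocalized lam ω θ)
    (ha : IsSelfAdjoint a)
    (happ : ∀ f n, a f n = f (n + 1) + f (n - 1)
      + ((lam * Real.cos (2 * Real.pi * (θ + (n : ℝ) * ω)) : ℝ) : ℂ) * f n) {w : l2Z}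
    (hw : ∀ (E : ℝ) x, a x = (E : ℂ) • x → inner ℂ x w = 0) : w = 0 := by
  refine l2Z_eq_zero_of_inner_single fun m => ?_
  obtain ⟨μ, hfin, T, hTn, hTm, hTT, hmul⟩ := ha.exists_spectralMeasure (lp.single 2 m (1 : ℂ))
  have hreal : ∀ z : spectrum ℂ a, (((z : ℂ).re : ℝ) : ℂ) = z := fun z =>
    (ha.mem_spectrum_eq_re z.2).symm
  have hmul' : ∀ x, T (a x) =ᵐ[μ] fun z : spectrum ℂ a => (((z : ℂ).re : ℝ) : ℂ) * T x z :=
    fun x => (hmul x).mono fun z hz => by simpa only [hreal] using hz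
  exact ContinuousLinearMap.inner_eq_zero_of_forall_eigenvector ha.isSymmetric
    ha.isSymmetric.countable_eigenvalues_l2Z
    (fun z z' h => Subtype.ext (by rw [← hreal z, ← hreal z', h])) hTT hmul'
    (hloc.ae_mem_eigenvalues happ hTn hTm hmul') fun E _ x hx => hw E x hx

theorem IsLocalized.expDecay (hloc : IsLocalized lam ω θ) {f : l2Z} (hf : f ≠ 0) {E : ℝ}
    (h : AMEigenEq lam ω θ f E) : ExpDecay f := by
  obtain ⟨m, hm⟩ : ∃ m, f m ≠ 0 := by
    by_contra! hcon
    exact hf (lp.ext (funext hcon))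
  refine hloc E f m ‖f‖ h hm fun n => (lp.norm_apply_le_norm two_ne_zero f n).trans ?_
  exact le_mul_of_one_le_right (norm_nonneg f) (by linarith [abs_nonneg (n : ℝ)])

end AlmostMathieu

/-- **Jitomirskaya**: for the almost Mathieu operator with `λ > 2`, Diophantine frequency `ω`
and almost every phase `θ`, the spectrum is pure point with exponentially decaying
eigenfunctions: there is an orthonormal (Hilbert) basis of `ℓ²(ℤ)` consisting of eigenvectors,
each of which decays exponentially. -/
theorem almostMathieu_anderson_localization_supercritical
    (lam ω : ℝ) (hlam : 2 < lam) (hω : Diophantine ω) :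
    ∀ᵐ θ : ℝ ∂volume, ∃ (ι : Type) (v : HilbertBasis ι ℂ l2Z), ∀ i : ι,
      ∃ E : ℝ, AMEigenEq lam ω θ (v i) E ∧ ExpDecay (v i) := by
  filter_upwards [ae_isLocalized hlam hω] with θ hloc
  obtain ⟨a, ha, happ⟩ := exists_isSelfAdjoint_jacobi (C := |lam|)
    (V := fun n => lam * Real.cos (2 * Real.pi * (θ + (n : ℝ) * ω))) fun n => by
      rw [abs_mul]
      exact mul_le_of_le_one_right (abs_nonneg _) (Real.abs_cos_le_one _)
  obtain ⟨ι, v, hv⟩ := ContinuousLinearMap.exists_hilbertBasis_of_eigenvectors ha.isSymmetric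
    fun w hw => hloc.eq_zero_of_forall_inner_eigenvector ha happ hw
  refine ⟨ι, v, fun i => ?_⟩
  obtain ⟨E, hE⟩ := hv i
  have h := (apply_eq_smul_iff_aMEigenEq happ _ _).1 hE
  exact ⟨E, h, hloc.expDecay (v.orthonormal.ne_zero i) h⟩
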